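/- arXiv:1304.0733 — 4 statements merged into one kernel-verified Lean document; each statement's English description precedes it below -/
import Mathlib

section
/- For every n ≥ 3 there exist R-trivial regular languages L₁ and L₂ over a three-letter alphabet such that sc(L₁) = sc(L₂) = n, sc(L₁^R) = sc(L₂^R) = 2^{n-1}, the minimal DFA of L₁ has a dead state, and the minimal DFA of L₂ has no dead state. -/
/-- A DFA is *partially ordered* if its reachability relation
`p ≼ q ↔ ∃ w, M.evalFrom p w = q` is antisymmetric (hence a partial order). -/
def DFA.PartiallyOrderedDFA {α σ : Type} (M : DFA α σ) : Prop :=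
  ∀ p q : σ, (∃ w : List α, M.evalFrom p w = q) → (∃ w : List α, M.evalFrom q w = p) → p = q

/-- A DFA is *minimal* if every state is reachable from the initial state and
all pairs of distinct states are distinguishable. -/
def DFA.MinimalDFA {α σ : Type} (M : DFA α σ) : Prop :=
  (∀ q : σ, ∃ w : List α, M.evalFrom M.start w = q) ∧
  (∀ p q : σ, p ≠ q →
    ∃ w : List α, ¬ (M.evalFrom p w ∈ M.accept ↔ M.evalFrom q w ∈ M.accept))

/-- The *state complexity* of a language: the least number of states of a
(complete, deterministic) finite automaton accepting it. -/
noncomputable def stateComplexity {α : Type} (L : Language α) : ℕ :=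
  sInf {n : ℕ | ∃ M : DFA α (Fin n), M.accepts = L}

/-- A regular language is *R-trivial* iff its minimal DFA is partially ordered. -/
def IsRTrivial {α : Type} (L : Language α) : Prop :=
  ∃ (n : ℕ) (M : DFA α (Fin n)), M.MinimalDFA ∧ M.accepts = L ∧ M.PartiallyOrderedDFA

/-- A regular language is *J-trivial* iff the minimal DFAs of both the language
and its reverse are partially ordered. -/
def IsJTrivial {α : Type} (L : Language α) : Prop :=
  IsRTrivial L ∧ IsRTrivial L.reverse

/-- A *dead state*: a non-accepting state with a self-loop under every letter. -/
def DFA.DeadState {α σ : Type} (M : DFA α σ) (d : σ) : Prop :=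
  d ∉ M.accept ∧ ∀ a : α, M.step d a = d

namespace DFA

variable {α σ : Type}

theorem MinimalDFA.stateComplexity_eq [Fintype σ] {M : DFA α σ} (hM : M.MinimalDFA) :
    stateComplexity M.accepts = Fintype.card σ := by
  apply le_antisymm
  · exact Nat.sInf_le ⟨M.reindex (Fintype.equivFin σ), by simp⟩
  · refine le_csInf ⟨_, M.reindex (Fintype.equivFin σ), by simp⟩ ?_
    rintro k ⟨N, hN⟩
    choose w hw using hM.1
    have hinj : Function.Injective fun q => N.eval (w q) := by
      intro p q hpq
      by_contra hne
      obtain ⟨v, hv⟩ := hM.2 p q hne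
      have key : ∀ r, M.evalFrom r v ∈ M.accept ↔ N.evalFrom (N.eval (w r)) v ∈ N.accept := by
        intro r
        have h : w r ++ v ∈ M.accepts ↔ w r ++ v ∈ N.accepts := by rw [hN]
        simpa [mem_accepts, eval, evalFrom_of_append, hw r] using h
      have hpq' : N.eval (w p) = N.eval (w q) := hpq
      exact hv (by rw [key, key, hpq'])
    simpa using Fintype.card_le_of_injective _ hinj

theorem MinimalDFA.compl {M : DFA α σ} (hM : M.MinimalDFA) : Mᶜ.MinimalDFA :=
  ⟨hM.1, fun p q hpq => by
    obtain ⟨w, hw⟩ := hM.2 p q hpq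
    exact ⟨w, fun h => hw (not_iff_not.mp h)⟩⟩

theorem partiallyOrderedDFA_of_le_step [PartialOrder σ] {M : DFA α σ}
    (h : ∀ q a, q ≤ M.step q a) : M.PartiallyOrderedDFA := by
  have le_evalFrom : ∀ (w : List α) (q : σ), q ≤ M.evalFrom q w := by
    intro w
    induction w with
    | nil => intro q; exact le_rfl
    | cons a w ih => intro q; exact (h q a).trans (ih _)
  rintro p q ⟨v, rfl⟩ ⟨w, hw⟩
  exact le_antisymm (le_evalFrom v p) ((le_evalFrom w _).trans_eq hw)

end DFA

theorem Language.reverse_compl {α : Type} (L : Language α) : Lᶜ.reverse = L.reverseᶜ := rfl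

/-- The chain automaton on `0, …, m + 1`: both `0` and `1` move `q` to `q + 1` for `q + 1 < m`,
`0` moves `m - 1` to `m`, `1` moves `m - 1` to the sink `m + 1`, and `2` moves `m` to the sink. -/
def chainDFA (m : ℕ) : DFA (Fin 3) (Fin (m + 2)) where
  step q a :=
    if h : q.val < m ∧ a ≠ 2 then
      if a = 1 ∧ q.val + 1 = m then Fin.last (m + 1) else ⟨q.val + 1, by omega⟩
    else if q.val = m ∧ a = 2 then Fin.last (m + 1) else q
  start := 0
  accept := {q | q.val = m}

theorem le_chainDFA_step (m : ℕ) (q : Fin (m + 2)) (a : Fin 3) : q ≤ (chainDFA m).step q a := by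
  simp only [chainDFA, Fin.le_def]
  split_ifs <;> simp <;> omega

theorem chainDFA_step_last (m : ℕ) (a : Fin 3) :
    (chainDFA m).step (Fin.last (m + 1)) a = Fin.last (m + 1) := by
  simp [chainDFA]

theorem chainDFA_reachable (m : ℕ) (q : Fin (m + 2)) :
    ∃ w, (chainDFA m).evalFrom (chainDFA m).start w = q := by
  have chain : ∀ k, ∀ hk : k ≤ m,
      ∃ w, (chainDFA m).evalFrom (chainDFA m).start w = ⟨k, by omega⟩ := by
    intro k
    induction k with
    | zero => exact fun _ => ⟨[], rfl⟩
    | succ k ih =>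
      intro hk
      obtain ⟨w, hw⟩ := ih (by omega)
      refine ⟨w ++ [0], ?_⟩
      rw [DFA.evalFrom_append_singleton, hw]
      have : k < m := hk
      simp [chainDFA, this]
  by_cases hq : q.val ≤ m
  · exact chain q hq
  · obtain ⟨w, hw⟩ := chain m le_rfl
    refine ⟨w ++ [2], ?_⟩
    rw [DFA.evalFrom_append_singleton, hw]
    ext
    simp [chainDFA]
    omega

/-- The reverse subset automaton of `chainDFA m`; no set contains the sink. -/
def chainReverseDFA (m : ℕ) : DFA (Fin 3) (Set (Fin (m + 1))) where
  step S a := {q | (chainDFA m).step q.castSucc a ∈ Fin.castSucc '' S}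
  start := {Fin.last m}
  accept := {S | 0 ∈ S}

theorem mem_chainReverseDFA_step {m : ℕ} (S : Set (Fin (m + 1))) (a : Fin 3) (q : Fin (m + 2)) :
    q ∈ Fin.castSucc '' (chainReverseDFA m).step S a ↔
      (chainDFA m).step q a ∈ Fin.castSucc '' S := by
  induction q using Fin.lastCases with
  | last =>
    rw [chainDFA_step_last]
    simp [Fin.castSucc_ne_last]
  | cast q =>
    rw [(Fin.castSucc_injective _).mem_set_image]
    rfl

theorem mem_chainReverseDFA_evalFrom {m : ℕ} (w : List (Fin 3)) :
    ∀ (S : Set (Fin (m + 1))) (q : Fin (m + 2)),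
      q ∈ Fin.castSucc '' (chainReverseDFA m).evalFrom S w ↔
        (chainDFA m).evalFrom q w.reverse ∈ Fin.castSucc '' S := by
  induction w with
  | nil => intro S q; rfl
  | cons a w ih =>
    intro S q
    rw [List.reverse_cons, DFA.evalFrom_append_singleton, ← mem_chainReverseDFA_step]
    exact ih _ q

theorem chainReverseDFA_evalFrom_mem_accept {m : ℕ} (S : Set (Fin (m + 1))) (w : List (Fin 3)) :
    (chainReverseDFA m).evalFrom S w ∈ (chainReverseDFA m).accept ↔
      (chainDFA m).evalFrom (chainDFA m).start w.reverse ∈ Fin.castSucc '' S := by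
  rw [← mem_chainReverseDFA_evalFrom]
  exact ((Fin.castSucc_injective _).mem_set_image (a := 0)).symm

theorem chainReverseDFA_accepts (m : ℕ) :
    (chainReverseDFA m).accepts = (chainDFA m).accepts.reverse := by
  ext w
  rw [Language.mem_reverse, DFA.mem_accepts, DFA.mem_accepts]
  refine (chainReverseDFA_evalFrom_mem_accept _ w).trans ?_
  simp [chainReverseDFA, chainDFA, DFA.eval, Fin.ext_iff, eq_comm]

theorem chainReverseDFA_reachable_suffix (m k : ℕ) (hk : k ≤ m) :
    ∀ T : Set (Fin (m + 1)), ∃ w,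
      Fin.last m ∈ (chainReverseDFA m).evalFrom (chainReverseDFA m).start w ∧
      ∀ q : Fin (m + 1), q.val < m → m ≤ q.val + k →
        (q ∈ (chainReverseDFA m).evalFrom (chainReverseDFA m).start w ↔ q ∈ T) := by
  induction k with
  | zero => exact fun T => ⟨[], rfl, fun q _ _ => by omega⟩
  | succ k ih =>
    intro T
    obtain ⟨w, hlast, hw⟩ := ih (by omega) {q | ∃ p ∈ T, q.val = p.val + 1}
    classical
    refine ⟨w ++ [if (⟨m - 1, by omega⟩ : Fin (m + 1)) ∈ T then 0 else 1], ?_, ?_⟩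
    · rw [DFA.evalFrom_append_singleton]
      refine ⟨_, hlast, ?_⟩
      split_ifs <;> simp [chainDFA, Fin.ext_iff]
    · intro q hqm hqk
      rw [DFA.evalFrom_append_singleton]
      set S := (chainReverseDFA m).evalFrom (chainReverseDFA m).start w
      rw [← (Fin.castSucc_injective _).mem_set_image, mem_chainReverseDFA_step]
      by_cases hq : q.val + 1 = m
      · have hq' : (⟨m - 1, by omega⟩ : Fin (m + 1)) = q := Fin.ext (by simp; omega)
        rw [hq']
        by_cases hT : q ∈ T
        · have : (chainDFA m).step q.castSucc 0 = (Fin.last m).castSucc := by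
            ext; simp [chainDFA, hqm, hq]
          simp only [hT, if_true, this, iff_true]
          exact ⟨_, hlast, rfl⟩
        · have : (chainDFA m).step q.castSucc 1 = Fin.last (m + 1) := by
            simp [chainDFA, hqm, hq]
          simp [hT, this, Fin.castSucc_ne_last]
      · have hstep : ∀ a : Fin 3, a ≠ 2 →
            (chainDFA m).step q.castSucc a = (⟨q.val + 1, by omega⟩ : Fin (m + 1)).castSucc := by
          intro a ha
          ext
          simp [chainDFA, hqm, hq, ha]
        rw [hstep _ (by split_ifs <;> decide), (Fin.castSucc_injective _).mem_set_image,
          hw _ (by simp; omega) (by simp; omega)]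
        constructor
        · rintro ⟨p, hp, h⟩
          have : q = p := Fin.ext (by simpa using h)
          exact this ▸ hp
        · exact fun h => ⟨q, h, rfl⟩

theorem chainReverseDFA_reachable {m : ℕ} (T : Set (Fin (m + 1))) :
    ∃ w, (chainReverseDFA m).evalFrom (chainReverseDFA m).start w = T := by
  obtain ⟨w, hlast, hw⟩ := chainReverseDFA_reachable_suffix m m le_rfl T
  by_cases hT : Fin.last m ∈ T
  · refine ⟨w, ?_⟩
    ext q
    by_cases hq : q = Fin.last m
    · subst hq; exact iff_of_true hlast hT
    · exact hw q (Fin.val_lt_last hq) (by omega)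
  · refine ⟨w ++ [2], ?_⟩
    rw [DFA.evalFrom_append_singleton]
    ext q
    rw [← (Fin.castSucc_injective _).mem_set_image, mem_chainReverseDFA_step]
    by_cases hq : q = Fin.last m
    · subst hq
      have : (chainDFA m).step (Fin.last m).castSucc 2 = Fin.last (m + 1) := by simp [chainDFA]
      simp [hT, this, Fin.castSucc_ne_last]
    · have hlt : q.val < m := Fin.val_lt_last hq
      have : (chainDFA m).step q.castSucc 2 = q.castSucc := by
        simp [chainDFA, hlt.ne]
      rw [this, (Fin.castSucc_injective _).mem_set_image]
      exact hw q hlt (by omega)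

theorem chainReverseDFA_minimal (m : ℕ) : (chainReverseDFA m).MinimalDFA := by
  refine ⟨chainReverseDFA_reachable, fun S T hST => ?_⟩
  by_contra! h
  refine hST (Set.ext fun q => ?_)
  obtain ⟨w, hw⟩ := chainDFA_reachable m q.castSucc
  have := h w.reverse
  rwa [chainReverseDFA_evalFrom_mem_accept, chainReverseDFA_evalFrom_mem_accept,
    List.reverse_reverse, hw, (Fin.castSucc_injective _).mem_set_image,
    (Fin.castSucc_injective _).mem_set_image] at this

theorem chainDFA_minimal (m : ℕ) : (chainDFA m).MinimalDFA := by
  refine ⟨chainDFA_reachable m, ?_⟩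
  have separate : ∀ p q : Fin (m + 2), p < q →
      ∃ w, ¬((chainDFA m).evalFrom p w ∈ (chainDFA m).accept ↔
        (chainDFA m).evalFrom q w ∈ (chainDFA m).accept) := by
    intro p q hpq
    obtain ⟨w, hw⟩ := chainReverseDFA_reachable ({p.castLT (by omega)} : Set (Fin (m + 1)))
    have key : ∀ r, (chainDFA m).evalFrom r w.reverse ∈ (chainDFA m).accept ↔ r = p := by
      intro r
      have := mem_chainReverseDFA_evalFrom w (chainReverseDFA m).start r
      rw [hw] at this
      simpa [chainReverseDFA, chainDFA, Fin.ext_iff, eq_comm] using this.symm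
    refine ⟨w.reverse, ?_⟩
    rw [key, key]
    simp [hpq.ne']
  intro p q hpq
  rcases lt_or_gt_of_ne hpq with h | h
  · exact separate p q h
  · obtain ⟨w, hw⟩ := separate q p h
    exact ⟨w, fun h' => hw h'.symm⟩

theorem chainDFA_compl_not_deadState (m : ℕ) : ¬∃ d, (chainDFA m)ᶜ.DeadState d := by
  rintro ⟨d, hd, hstep⟩
  have hdm : d.val = m := not_not.mp hd
  have h : (chainDFA m).step d 2 = d := hstep 2
  simp [chainDFA, hdm, Fin.ext_iff] at h

theorem statement1 (n : ℕ) (hn : 3 ≤ n) :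
    ∃ L₁ L₂ : Language (Fin 3),
      IsRTrivial L₁ ∧ IsRTrivial L₂ ∧
      stateComplexity L₁ = n ∧ stateComplexity L₂ = n ∧
      stateComplexity L₁.reverse = 2 ^ (n - 1) ∧
      stateComplexity L₂.reverse = 2 ^ (n - 1) ∧
      (∃ M : DFA (Fin 3) (Fin n), M.MinimalDFA ∧ M.accepts = L₁ ∧ ∃ d, M.DeadState d) ∧
      (∃ M : DFA (Fin 3) (Fin n), M.MinimalDFA ∧ M.accepts = L₂ ∧ ¬ ∃ d, M.DeadState d) := by
  obtain ⟨m, rfl⟩ : ∃ m, n = m + 2 := ⟨n - 2, by omega⟩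
  have hM := chainDFA_minimal m
  have hR := chainReverseDFA_minimal m
  refine ⟨(chainDFA m).accepts, (chainDFA m)ᶜ.accepts,
    ⟨_, _, hM, rfl, DFA.partiallyOrderedDFA_of_le_step (le_chainDFA_step m)⟩,
    ⟨_, _, hM.compl, rfl, DFA.partiallyOrderedDFA_of_le_step (le_chainDFA_step m)⟩,
    ?_, ?_, ?_, ?_,
    ⟨_, hM, rfl, Fin.last (m + 1), ?_, chainDFA_step_last m⟩,
    ⟨_, hM.compl, rfl, chainDFA_compl_not_deadState m⟩⟩
  · simpa using hM.stateComplexity_eq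
  · simpa using hM.compl.stateComplexity_eq
  · rw [← chainReverseDFA_accepts, hR.stateComplexity_eq]
    simp
  · rw [DFA.accepts_compl, Language.reverse_compl, ← chainReverseDFA_accepts,
      ← DFA.accepts_compl, hR.compl.stateComplexity_eq]
    simp
  · simp [chainDFA]
end

section
/- For every n ≥ 3 there exist J-trivial regular languages L₁ and L₂ over an alphabet of size n-1 such that sc(L₁) = sc(L₂) = n, sc(L₁^R) = sc(L₂^R) = 2^{n-1}, the minimal DFA of L₁ has a dead state, and the minimal DFA of L₂ has no dead state. -/
namespace DFA

variable {α σ τ : Type}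

theorem MinimalDFA.reindex {M : DFA α σ} (h : M.MinimalDFA) (g : σ ≃ τ) :
    (DFA.reindex g M).MinimalDFA := by
  refine ⟨fun q => ?_, fun p q hpq => ?_⟩
  · obtain ⟨w, hw⟩ := h.1 (g.symm q)
    exact ⟨w, by simp [evalFrom_reindex, hw]⟩
  · obtain ⟨w, hw⟩ := h.2 (g.symm p) (g.symm q) (g.symm.injective.ne hpq)
    exact ⟨w, by simpa [evalFrom_reindex] using hw⟩

theorem PartiallyOrderedDFA.reindex {M : DFA α σ} (h : M.PartiallyOrderedDFA) (g : σ ≃ τ) :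
    (DFA.reindex g M).PartiallyOrderedDFA := by
  rintro p q ⟨v, hv⟩ ⟨w, hw⟩
  refine g.symm.injective (h _ _ ⟨v, ?_⟩ ⟨w, ?_⟩)
  · simp [← hv, evalFrom_reindex]
  · simp [← hw, evalFrom_reindex]

theorem DeadState.reindex_iff {M : DFA α σ} (g : σ ≃ τ) (d : τ) :
    (DFA.reindex g M).DeadState d ↔ M.DeadState (g.symm d) := by
  simp [DeadState, Equiv.eq_symm_apply]

/-- A rank that strictly drops along every transition that is not a loop makes a DFA
partially ordered. -/
theorem PartiallyOrderedDFA.of_rank {M : DFA α σ} (r : σ → ℕ)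
    (hr : ∀ q a, M.step q a = q ∨ r (M.step q a) < r q) : M.PartiallyOrderedDFA := by
  have key (w : List α) : ∀ q, M.evalFrom q w = q ∨ r (M.evalFrom q w) < r q := by
    induction w with
    | nil => simp
    | cons a w ih =>
      intro q
      rw [evalFrom_cons]
      rcases hr q a with h | h
      · rw [h]
        exact ih q
      · rcases ih (M.step q a) with h' | h'
        · rw [h']
          exact .inr h
        · exact .inr (h'.trans h)
  rintro p q ⟨v, hv⟩ ⟨w, hw⟩
  rcases key v p with h | h
  · exact h.symm.trans hv
  · rcases key w q with h' | h'
    · exact hw.symm.trans h'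
    · rw [hv] at h
      rw [hw] at h'
      exact absurd h h'.asymm

theorem MinimalDFA.card_le [Fintype σ] [Fintype τ] {M : DFA α σ} (h : M.MinimalDFA)
    {N : DFA α τ} (hN : N.accepts = M.accepts) : Fintype.card σ ≤ Fintype.card τ := by
  choose w hw using h.1
  refine Fintype.card_le_of_injective (fun q => N.eval (w q)) fun p q hpq => ?_
  by_contra hne
  obtain ⟨v, hv⟩ := h.2 p q hne
  refine hv ?_
  have key (s : σ) : M.evalFrom s v ∈ M.accept ↔ N.evalFrom (N.eval (w s)) v ∈ N.accept := by
    have := Set.ext_iff.1 hN (w s ++ v)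
    change N.evalFrom N.start (w s ++ v) ∈ N.accept ↔
      M.evalFrom M.start (w s ++ v) ∈ M.accept at this
    rw [evalFrom_of_append, evalFrom_of_append, hw] at this
    exact this.symm
  rw [key, key]
  exact iff_of_eq (congrArg (fun s => N.evalFrom s v ∈ N.accept) hpq)

theorem MinimalDFA.stateComplexity_accepts [Fintype σ] {M : DFA α σ} (h : M.MinimalDFA) :
    stateComplexity M.accepts = Fintype.card σ := by
  have hmem : Fintype.card σ ∈ {n | ∃ N : DFA α (Fin n), N.accepts = M.accepts} :=
    ⟨DFA.reindex (Fintype.equivFin σ) M, accepts_reindex _ _⟩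
  refine le_antisymm (Nat.sInf_le hmem) (le_csInf ⟨_, hmem⟩ ?_)
  rintro n ⟨N, hN⟩
  simpa using h.card_le hN

theorem MinimalDFA.isRTrivial_accepts [Fintype σ] {M : DFA α σ} (h : M.MinimalDFA)
    (hp : M.PartiallyOrderedDFA) : IsRTrivial M.accepts :=
  ⟨_, DFA.reindex (Fintype.equivFin σ) M, h.reindex _, accepts_reindex _ _, hp.reindex _⟩

end DFA

namespace ReversalWitness

variable {m : ℕ} [NeZero m]

/-- The state `some i` moves to the sink `none` on its own letter, and the initial state `some 0`
moves to `some a` on every other letter `a`. -/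
def next : Option (Fin m) → Fin m → Option (Fin m)
  | none, _ => none
  | some i, a => if i = a then none else if i = 0 then some a else some i

/-- The witness automaton: for `b = true` the sink is the only rejecting state, for `b = false`
it is the only accepting state. -/
def forward (m : ℕ) [NeZero m] (b : Bool) : DFA (Fin m) (Option (Fin m)) where
  step := next
  start := some 0
  accept := {q | q.isSome = b}

/-- The automaton for the reverse of `forward m b`: its states are the sets of states other than
the sink, given by their indicator functions, and its transitions take preimages. -/
def backward (m : ℕ) [NeZero m] (b : Bool) : DFA (Fin m) (Fin m → Bool) where
  step x a i := (next (some i) a).elim false x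
  start _ := true
  accept := {x | x 0 = b}

theorem eq_of_eq_iff_eq {x y b : Bool} (h : x = b ↔ y = b) : x = y := by
  cases x <;> cases y <;> cases b <;> simp_all

variable (b : Bool)

theorem elim_backward_evalFrom (w : List (Fin m)) (x : Fin m → Bool) (q : Option (Fin m)) :
    q.elim false ((backward m b).evalFrom x w) =
      ((forward m b).evalFrom q w.reverse).elim false x := by
  induction w generalizing x with
  | nil => rfl
  | cons a w ih =>
    rw [DFA.evalFrom_cons, ih, List.reverse_cons, DFA.evalFrom_append_singleton]
    generalize (forward m b).evalFrom q w.reverse = p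
    cases p <;> rfl

theorem elim_backward_eval (w : List (Fin m)) (q : Option (Fin m)) :
    q.elim false ((backward m b).eval w) =
      ((forward m b).evalFrom q w.reverse).isSome := by
  rw [DFA.eval, elim_backward_evalFrom]
  generalize (forward m b).evalFrom q w.reverse = p
  cases p <;> rfl

theorem accepts_backward : (backward m b).accepts = (forward m b).accepts.reverse := by
  ext w
  have := elim_backward_eval b w (some 0)
  change ((backward m b).eval w) 0 = b ↔ ((forward m b).eval w.reverse).isSome = b
  rw [← show _ = ((forward m b).eval w.reverse).isSome from this]
  rfl

theorem forward_reachable (q : Option (Fin m)) : ∃ w, (forward m b).eval w = q := by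
  rcases q with _ | i
  · exact ⟨[0], by simp [DFA.eval, forward, next]⟩
  · by_cases hi : i = 0
    · exact ⟨[], by simp [DFA.eval, forward, hi]⟩
    · exact ⟨[i], by simp [DFA.eval, forward, next, Ne.symm hi]⟩

theorem backward_step_zero (x : Fin m → Bool) :
    (backward m b).step x 0 = Function.update x 0 false := by
  ext i
  by_cases hi : i = 0 <;> simp [backward, next, hi]

theorem backward_step_of_ne (x : Fin m → Bool) {a : Fin m} (ha : a ≠ 0) :
    (backward m b).step x a = Function.update (Function.update x a false) 0 (x a) := by
  ext i
  by_cases hi : i = 0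
  · simp [backward, next, hi, ha.symm]
  · by_cases hia : i = a <;> simp [backward, next, hi, hia, ha]

theorem backward_reachable (x : Fin m → Bool) : ∃ w, (backward m b).eval w = x := by
  have key (s : Finset (Fin m)) (hs : 0 ∉ s) :
      ∃ w, (backward m b).eval w = fun i => decide (i ∉ s) := by
    induction s using Finset.induction_on with
    | empty => exact ⟨[], by simp [DFA.eval, backward]⟩
    | insert a s has ih =>
      rw [Finset.mem_insert, not_or] at hs
      obtain ⟨w, hw⟩ := ih hs.2
      refine ⟨w ++ [a], ?_⟩
      rw [DFA.eval_append_singleton, hw, backward_step_of_ne b _ (Ne.symm hs.1)]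
      ext i
      by_cases hi : i = 0
      · simp [hi, has, hs]
      · by_cases hia : i = a <;> simp [hi, hia, Ne.symm hs.1]
  obtain ⟨w, hw⟩ := key {i | i ≠ 0 ∧ x i = false} (by simp)
  by_cases h0 : x 0 = true
  · refine ⟨w, hw.trans (funext fun i => ?_)⟩
    by_cases hi : i = 0 <;> simp [hi, h0]
  · refine ⟨w ++ [0], ?_⟩
    rw [DFA.eval_append_singleton, hw, backward_step_zero]
    ext i
    by_cases hi : i = 0 <;> simp [hi, h0]

theorem minimalDFA_forward : (forward m b).MinimalDFA := by
  refine ⟨forward_reachable b, fun p q hpq => ?_⟩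
  obtain ⟨x, hx⟩ : ∃ x : Fin m → Bool, p.elim false x ≠ q.elim false x := by
    rcases p with _ | i
    · rcases q with _ | j
      · exact absurd rfl hpq
      · exact ⟨fun _ => true, by simp⟩
    · refine ⟨fun k => decide (k = i), ?_⟩
      rcases q with _ | j
      · simp
      · have : j ≠ i := fun h => hpq (h ▸ rfl)
        simp [this]
  obtain ⟨w, rfl⟩ := backward_reachable b x
  rw [elim_backward_eval, elim_backward_eval] at hx
  exact ⟨w.reverse, fun h => hx (eq_of_eq_iff_eq h)⟩

theorem minimalDFA_backward : (backward m b).MinimalDFA := by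
  refine ⟨backward_reachable b, fun x y hxy => ?_⟩
  obtain ⟨i, hi⟩ := Function.ne_iff.1 hxy
  obtain ⟨w, hw⟩ := forward_reachable b (some i)
  have key (z : Fin m → Bool) : (backward m b).evalFrom z w.reverse 0 = z i := by
    have := elim_backward_evalFrom b w.reverse z (some 0)
    rw [List.reverse_reverse, show (forward m b).evalFrom (some 0) w = some i from hw] at this
    exact this
  refine ⟨w.reverse, fun h => hi ?_⟩
  change _ = b ↔ _ = b at h
  rw [key, key] at h
  exact eq_of_eq_iff_eq h

theorem partiallyOrderedDFA_forward : (forward m b).PartiallyOrderedDFA := by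
  refine .of_rank (fun q => q.elim 0 fun i => if i = 0 then 2 else 1) ?_
  rintro (_ | i) a
  · exact .inl rfl
  · by_cases hia : i = a
    · right
      by_cases hi : a = 0 <;> simp [forward, next, hia, hi]
    · by_cases hi : i = 0
      · subst hi
        simp [forward, next, hia, Ne.symm hia]
      · simp [forward, next, hia, hi]

theorem partiallyOrderedDFA_backward : (backward m b).PartiallyOrderedDFA := by
  refine .of_rank
    (fun x => 2 * (Finset.univ.filter fun i => i ≠ 0 ∧ x i = true).card + (x 0).toNat) ?_
  intro x a
  by_cases ha : a = 0
  · subst ha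
    rw [backward_step_zero]
    cases h0 : x 0
    · left
      rw [← h0, Function.update_eq_self]
    · right
      simp +contextual [Function.update_apply]
  · rw [backward_step_of_ne b x ha]
    cases hxa : x a
    · rw [← hxa, Function.update_eq_self, hxa]
      cases h0 : x 0
      · left
        rw [← h0, Function.update_eq_self]
      · right
        simp +contextual [Function.update_apply]
    · right
      have hlt : (Finset.univ.filter fun i => i ≠ 0 ∧
          Function.update (Function.update x a false) 0 true i = true).card <
          (Finset.univ.filter fun i => i ≠ 0 ∧ x i = true).card := by
        refine Finset.card_lt_card (Finset.ssubset_iff_of_subset (fun i => ?_) |>.2 ⟨a, ?_, ?_⟩)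
        · by_cases hia : i = a <;> simp +contextual [Function.update_apply, hia]
        · simp [ha, hxa]
        · simp [ha]
      have h1 : (Function.update (Function.update x a false) 0 true 0).toNat ≤ 1 :=
        Bool.toNat_le _
      omega

theorem isJTrivial_accepts_forward : IsJTrivial (forward m b).accepts :=
  ⟨(minimalDFA_forward b).isRTrivial_accepts (partiallyOrderedDFA_forward b), by
    rw [← accepts_backward]
    exact (minimalDFA_backward b).isRTrivial_accepts (partiallyOrderedDFA_backward b)⟩

theorem stateComplexity_accepts_forward : stateComplexity (forward m b).accepts = m + 1 := by
  simpa using (minimalDFA_forward (m := m) b).stateComplexity_accepts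

theorem stateComplexity_reverse_accepts_forward :
    stateComplexity (forward m b).accepts.reverse = 2 ^ m := by
  rw [← accepts_backward]
  simpa using (minimalDFA_backward (m := m) b).stateComplexity_accepts

theorem deadState_forward_none : (forward m true).DeadState none :=
  ⟨Bool.false_ne_true, fun _ => rfl⟩

theorem not_deadState_forward_false (d : Option (Fin m)) : ¬ (forward m false).DeadState d := by
  rintro ⟨hacc, hstep⟩
  rcases d with _ | i
  · exact hacc rfl
  · simpa [forward, next] using hstep i

end ReversalWitness

open ReversalWitness in
theorem statement2 (n : ℕ) (hn : 3 ≤ n) :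
    ∃ L₁ L₂ : Language (Fin (n - 1)),
      IsJTrivial L₁ ∧ IsJTrivial L₂ ∧
      stateComplexity L₁ = n ∧ stateComplexity L₂ = n ∧
      stateComplexity L₁.reverse = 2 ^ (n - 1) ∧
      stateComplexity L₂.reverse = 2 ^ (n - 1) ∧
      (∃ M : DFA (Fin (n - 1)) (Fin n), M.MinimalDFA ∧ M.accepts = L₁ ∧ ∃ d, M.DeadState d) ∧
      (∃ M : DFA (Fin (n - 1)) (Fin n), M.MinimalDFA ∧ M.accepts = L₂ ∧ ¬ ∃ d, M.DeadState d) := by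
  obtain ⟨m, rfl⟩ : ∃ m, n = m + 1 := ⟨n - 1, by omega⟩
  rw [Nat.add_sub_cancel]
  have : NeZero m := ⟨by omega⟩
  let e : Option (Fin m) ≃ Fin (m + 1) := finSuccEquivLast.symm
  refine ⟨(forward m true).accepts, (forward m false).accepts,
    isJTrivial_accepts_forward _, isJTrivial_accepts_forward _,
    stateComplexity_accepts_forward _, stateComplexity_accepts_forward _,
    stateComplexity_reverse_accepts_forward _, stateComplexity_reverse_accepts_forward _,
    ⟨DFA.reindex e (forward m true), (minimalDFA_forward _).reindex e, DFA.accepts_reindex _ _,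
      e none, ?_⟩,
    ⟨DFA.reindex e (forward m false), (minimalDFA_forward _).reindex e, DFA.accepts_reindex _ _,
      ?_⟩⟩
  · rw [DFA.DeadState.reindex_iff, Equiv.symm_apply_apply]
    exact deadState_forward_none
  · rintro ⟨d, hd⟩
    exact not_deadState_forward_false _ ((DFA.DeadState.reindex_iff e d).1 hd)
end

section
/- For every n ≥ 3 there exists an R-trivial regular language L over a two-letter alphabet with sc(L) = n such that sc(L^R) ≥ 2^{n-2}. -/
namespace Language

variable {α : Type} {L : Language α}

theorem IsRegular.exists_dfa_fin (h : L.IsRegular) :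
    ∃ (n : ℕ) (M : DFA α (Fin n)), M.accepts = L := by
  obtain ⟨σ, _, M, rfl⟩ := h
  exact ⟨Fintype.card σ, DFA.reindex (Fintype.equivFin σ) M, M.accepts_reindex _⟩

/-- A family of words that are pairwise inequivalent for the Nerode relation of a regular language
bounds its state complexity from below. -/
theorem IsRegular.card_le_stateComplexity (h : L.IsRegular) {ι : Type} [Fintype ι]
    (u : ι → List α) (hu : ∀ i j, i ≠ j → ∃ w, ¬ (u i ++ w ∈ L ↔ u j ++ w ∈ L)) :
    Fintype.card ι ≤ stateComplexity L := by
  have hne : {n : ℕ | ∃ M : DFA α (Fin n), M.accepts = L}.Nonempty := h.exists_dfa_fin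
  obtain ⟨M, hM⟩ := Nat.sInf_mem hne
  have hinj : Function.Injective fun i => M.eval (u i) := by
    intro i j hij
    by_contra hne
    obtain ⟨w, hw⟩ := hu i j hne
    apply hw
    simp only [DFA.eval] at hij
    simp only [← hM, DFA.mem_accepts, DFA.eval, DFA.evalFrom_of_append, hij]
  simpa [stateComplexity] using Fintype.card_le_of_injective _ hinj

end Language

theorem DFA.MinimalDFA.stateComplexity_accepts_s4 {α : Type} {n : ℕ} {M : DFA α (Fin n)}
    (hM : M.MinimalDFA) : stateComplexity M.accepts = n := by
  apply le_antisymm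
  · exact Nat.sInf_le ⟨M, rfl⟩
  · choose u hu using hM.1
    have hreg : M.accepts.IsRegular := ⟨Fin n, inferInstance, M, rfl⟩
    simpa using hreg.card_le_stateComplexity u fun p q hpq => by
      obtain ⟨w, hw⟩ := hM.2 p q hpq
      refine ⟨w, ?_⟩
      simpa only [DFA.mem_accepts, DFA.eval, DFA.evalFrom_of_append, hu] using hw

/-- The automaton that counts up to `m`, reads one more letter there, and moves to the accepting
sink `m + 1` or to the rejecting sink `m + 2` according to that letter. -/
def letterAtDFA (m : ℕ) : DFA (Fin 2) (Fin (m + 3)) where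
  step q a :=
    if h : (q : ℕ) < m then ⟨q + 1, by omega⟩
    else if (q : ℕ) = m then ⟨m + 1 + a, by omega⟩ else q
  start := 0
  accept := {q | (q : ℕ) = m + 1}

namespace letterAtDFA

variable {m : ℕ}

theorem mem_accept {q : Fin (m + 3)} : q ∈ (letterAtDFA m).accept ↔ (q : ℕ) = m + 1 := Iff.rfl

theorem step_of_lt {q : Fin (m + 3)} (h : (q : ℕ) < m) (a : Fin 2) :
    ((letterAtDFA m).step q a : ℕ) = q + 1 := by
  simp [letterAtDFA, h]

theorem step_of_eq {q : Fin (m + 3)} (h : (q : ℕ) = m) (a : Fin 2) :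
    ((letterAtDFA m).step q a : ℕ) = m + 1 + a := by
  simp [letterAtDFA, h]

theorem step_of_gt {q : Fin (m + 3)} (h : m < (q : ℕ)) (a : Fin 2) :
    (letterAtDFA m).step q a = q := by
  simp [letterAtDFA, h.not_gt, h.ne']

theorem le_step (q : Fin (m + 3)) (a : Fin 2) : q ≤ (letterAtDFA m).step q a := by
  rw [Fin.le_def]
  rcases lt_trichotomy (q : ℕ) m with h | h | h
  · rw [step_of_lt h]; omega
  · rw [step_of_eq h]; omega
  · rw [step_of_gt h]

theorem le_evalFrom (q : Fin (m + 3)) (w : List (Fin 2)) :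
    q ≤ (letterAtDFA m).evalFrom q w := by
  induction w generalizing q with
  | nil => exact le_rfl
  | cons a w ih => exact (le_step q a).trans (ih _)

theorem partiallyOrderedDFA : (letterAtDFA m).PartiallyOrderedDFA := by
  rintro p q ⟨v, rfl⟩ ⟨w, hw⟩
  exact le_antisymm (le_evalFrom _ _) ((le_evalFrom _ w).trans_eq hw)

theorem evalFrom_of_gt {q : Fin (m + 3)} (h : m < (q : ℕ)) (w : List (Fin 2)) :
    (letterAtDFA m).evalFrom q w = q := by
  induction w with
  | nil => rfl
  | cons a w ih => rw [DFA.evalFrom_cons, step_of_gt h, ih]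

theorem evalFrom_replicate {q : Fin (m + 3)} {j : ℕ} (h : q + j ≤ m) (a : Fin 2) :
    ((letterAtDFA m).evalFrom q (List.replicate j a) : ℕ) = q + j := by
  induction j generalizing q with
  | zero => rfl
  | succ j ih =>
    have hs := step_of_lt (q := q) (by omega) a
    rw [List.replicate_succ, DFA.evalFrom_cons, ih (by omega), hs]
    omega

theorem evalFrom_mem_accept_iff {q : Fin (m + 3)} (h : (q : ℕ) ≤ m) (w : List (Fin 2)) :
    (letterAtDFA m).evalFrom q w ∈ (letterAtDFA m).accept ↔ w[m - q]? = some 0 := by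
  induction w generalizing q with
  | nil => simp [mem_accept]; omega
  | cons a w ih =>
    rw [DFA.evalFrom_cons]
    rcases h.lt_or_eq with h | h
    · have hs := step_of_lt h a
      rw [ih (by omega), hs, show m - (q : ℕ) = m - (q + 1) + 1 by omega, List.getElem?_cons_succ]
    · have hs := step_of_eq h a
      rw [evalFrom_of_gt (by omega), mem_accept, hs, h]
      simp

theorem mem_accepts_iff (w : List (Fin 2)) : w ∈ (letterAtDFA m).accepts ↔ w[m]? = some 0 :=
  evalFrom_mem_accept_iff (q := 0) (Nat.zero_le m) w

theorem minimalDFA : (letterAtDFA m).MinimalDFA := by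
  constructor
  · intro q
    have hr (j : ℕ) (hj : j ≤ m) :=
      evalFrom_replicate (m := m) (q := (letterAtDFA m).start) (j := j)
        (by simpa [letterAtDFA] using hj) 0
    have h0 : ((letterAtDFA m).start : ℕ) = 0 := rfl
    simp only [h0, zero_add] at hr
    rcases le_or_gt (q : ℕ) m with h | h
    · exact ⟨List.replicate q 0, Fin.ext (hr q h)⟩
    · refine ⟨List.replicate m 0 ++ [⟨q - (m + 1), by omega⟩], Fin.ext ?_⟩
      rw [DFA.evalFrom_append_singleton, step_of_eq (hr m le_rfl)]
      simp only
      omega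
  · intro p q hpq
    wlog hlt : p < q generalizing p q
    · obtain ⟨w, hw⟩ := this q p hpq.symm (lt_of_le_of_ne (not_lt.mp hlt) hpq.symm)
      exact ⟨w, fun h => hw h.symm⟩
    rw [Fin.lt_def] at hlt
    rcases le_or_gt (q : ℕ) m with hq | hq
    · refine ⟨List.replicate (m - q + 1) 0, ?_⟩
      rw [evalFrom_mem_accept_iff hq, evalFrom_mem_accept_iff (by omega)]
      simp [List.getElem?_replicate]
      omega
    · rcases le_or_gt (p : ℕ) m with hp | hp
      · by_cases hq' : (q : ℕ) = m + 1
        · refine ⟨[], ?_⟩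
          simp only [DFA.evalFrom_nil, mem_accept]
          omega
        · refine ⟨List.replicate (m - p + 1) 0, ?_⟩
          rw [evalFrom_mem_accept_iff hp, evalFrom_of_gt hq, mem_accept]
          simp [hq']
      · refine ⟨[], ?_⟩
        simp only [DFA.evalFrom_nil, mem_accept]
        omega

theorem two_pow_le_stateComplexity_reverse :
    2 ^ (m + 1) ≤ stateComplexity (letterAtDFA m).accepts.reverse := by
  have hreg : (letterAtDFA m).accepts.IsRegular := ⟨_, inferInstance, letterAtDFA m, rfl⟩
  have key := hreg.reverse.card_le_stateComplexity
    (fun f : Fin (m + 1) → Fin 2 => (List.ofFn f).reverse) fun f g hfg => by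
      obtain ⟨i, hi⟩ := Function.ne_iff.mp hfg
      have hget (f : Fin (m + 1) → Fin 2) :
          (List.replicate (m - i) 0 ++ List.ofFn f)[m]? = some (f i) := by
        rw [List.getElem?_append_right (by simp), List.length_replicate,
          show m - (m - (i : ℕ)) = i by omega]
        simp [-List.ofFn_succ, i.is_le]
      refine ⟨List.replicate (m - i) 0, ?_⟩
      simp only [Language.mem_reverse, List.reverse_append, List.reverse_reverse,
        List.reverse_replicate, mem_accepts_iff, hget, Option.some.injEq]
      omega
  simpa using key

end letterAtDFA

theorem statement4 (n : ℕ) (hn : 3 ≤ n) :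
    ∃ L : Language (Fin 2), IsRTrivial L ∧ stateComplexity L = n ∧
      2 ^ (n - 2) ≤ stateComplexity L.reverse := by
  obtain ⟨m, rfl⟩ := Nat.exists_eq_add_of_le' hn
  exact ⟨(letterAtDFA m).accepts,
    ⟨m + 3, letterAtDFA m, letterAtDFA.minimalDFA, rfl, letterAtDFA.partiallyOrderedDFA⟩,
    letterAtDFA.minimalDFA.stateComplexity_accepts_s4,
    letterAtDFA.two_pow_le_stateComplexity_reverse⟩
end

section
/- Every R-trivial regular language L over a two-letter alphabet with sc(L) = 7 satisfies sc(L^R) ≤ 34, and there exists an R-trivial regular language L over the alphabet {a,b} with sc(L) = 7 and sc(L^R) = 34 (a witness is the language denoted by the regular expression b*ab*a(a+b)(ε + a(b* + b*a·a*b(a+b)*) + b·a*b(a+b)*)). -/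
open Computability

/-- The letter a as a singleton language over the alphabet {a, b} = Fin 2. -/
def A8 : Language (Fin 2) := {[0]}

/-- The letter b as a singleton language over the alphabet {a, b} = Fin 2. -/
def B8 : Language (Fin 2) := {[1]}

/-- The witness language b*ab*a(a+b)(ε + a(b* + b*a·a*b(a+b)*) + b·a*b(a+b)*). -/
def W8 : Language (Fin 2) :=
  B8∗ * A8 * B8∗ * A8 * (A8 + B8) *
    (1 + A8 * (B8∗ + B8∗ * A8 * A8∗ * B8 * (A8 + B8)∗) + B8 * (A8∗ * B8 * (A8 + B8)∗))

/-! ### Families of preimages, as bit masks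

A set `S` of states `0, …, k - 1` is the numeral with binary digits the indicator of `S`, and a
family of such sets is the numeral `W` with `W.testBit S` iff `S` belongs to the family. A letter is
given by a function `X : ℕ → ℕ` with `X i ≤ i`. The functions below are run by the kernel, hence
the raw recursors and the unbundled operations on `ℕ`. -/

namespace PreimageSearch

/-- `f n`, where `n` is evaluated before it is substituted into `f`. -/
noncomputable def force (n : ℕ) (f : ℕ → Bool) : Bool :=
  Nat.rec (f 0) (fun m _ => f (Nat.succ m)) n

/-- The `i`-th binary digit of `m`. -/
def bit (m i : ℕ) : ℕ := Nat.land (Nat.shiftRight m i) 1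

/-- The `S`-th byte of `T`. -/
def lookup (T S : ℕ) : ℕ := Nat.land (Nat.shiftRight T (Nat.mul 8 S)) 255

/-- The positions below `n` of the nonzero digits of `W`. -/
noncomputable def elems (W n : ℕ) : List ℕ :=
  Nat.rec [] (fun m ih => Bool.rec ih (m :: ih) (Nat.beq (bit W m) 1)) n

/-- The family of iterates of `S` under the map tabulated by `T`, or `W` if no fixed point is found
within `fuel` iterations. -/
noncomputable def orbit (T W fuel : ℕ) : ℕ → ℕ :=
  Nat.rec (fun _ => W) (fun _ ih S =>
    Bool.rec (Nat.lor (Nat.shiftLeft 1 S) (ih (lookup T S))) (Nat.shiftLeft 1 S)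
      (Nat.beq (lookup T S) S)) fuel

/-- The union over `S ∈ L` of the families `O (lookup T S)`, with the new state `k` added to each
member iff `x ∈ S`; empty if `x = k`. -/
noncomputable def edges (O : ℕ → ℕ) (T k x : ℕ) (L : List ℕ) : ℕ :=
  Bool.rec
    (List.rec 0 (fun S _ ih =>
      Nat.lor ih (Nat.shiftLeft (O (lookup T S)) (Nat.mul (bit S x) (Nat.pow 2 k)))) L)
    0 (Nat.beq x k)

/-- The family generated when a state `k` with successors `x` and `y` is added. -/
noncomputable def family (O : ℕ → ℕ) (k Ta Tb F x y f : ℕ) (L : List ℕ) : ℕ :=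
  Nat.lor (Nat.shiftLeft (O F) (Nat.mul f (Nat.pow 2 k)))
    (Nat.lor (edges O Ta k x L) (edges O Tb k y L))

/-- Add up pairs of adjacent `w`-bit digits. -/
def addPairs (w M m : ℕ) : ℕ := Nat.add (Nat.land m M) (Nat.land (Nat.shiftRight m w) M)

/-- The number of nonzero digits among the first 128 binary digits of `m`. The masks consist of
blocks of 4, 2 and 1 ones, alternating with blocks of zeros of the same length. -/
def popCount (m : ℕ) : ℕ :=
  Nat.mod (addPairs 4 20016609818878733144904388672456953615
    (addPairs 2 68056473384187692692674921486353642291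
      (addPairs 1 113427455640312821154458202477256070485 m))) 255

/-- Bounded universal quantification. -/
noncomputable def allBelow (p : ℕ → Bool) (n : ℕ) : Bool :=
  Nat.rec true (fun m ih => Bool.rec false ih (p m)) n

/-- The number whose `S`-th byte is the `x`-th digit of `S`, for `S < 128`. -/
def column (x : ℕ) : ℕ :=
  Nat.mul (Nat.mul (Nat.pow 256 (Nat.pow 2 x))
      (Nat.div (Nat.sub (Nat.pow 256 (Nat.pow 2 x)) 1) 255))
    (Nat.div (Nat.sub (Nat.pow 256 128) 1) (Nat.sub (Nat.pow 256 (Nat.pow 2 (Nat.succ x))) 1))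

/-- Extend a table of preimages by a state `k` with successor `x`. -/
def extend (T k x : ℕ) : ℕ := Nat.lor T (Nat.shiftLeft (column x) k)

/-- Supply `g` with the closure operator of the letters that loop at the new state `k`. -/
noncomputable def withOrbit (k Ta Tb W x y : ℕ) (g : (ℕ → ℕ) → Bool) : Bool :=
  Bool.rec (Bool.rec (g (Nat.shiftLeft 1)) (g (orbit Tb W 8)) (Nat.beq y k))
    (Bool.rec (g (orbit Ta W 8)) (g fun _ => W) (Nat.beq y k)) (Nat.beq x k)

/-- Is the family `Z` small enough to bound the final family by 34 sets, or else is the search below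
it successful? -/
noncomputable def child (ih : Bool → ℕ → ℕ → ℕ → ℕ → ℕ → Bool) (n : ℕ) (sym : Bool)
    (k Ta Tb F x y f Z : ℕ) : Bool :=
  Bool.rec
    (ih sym (Nat.succ k) (extend Ta k x) (extend Tb k y) (Nat.add F (Nat.mul f (Nat.pow 2 k))) Z)
    true (Nat.ble (popCount Z) (Nat.div 34 (Nat.pow 2 n)))

/-- Check both choices of acceptance for a new state with successors `x` and `y`. -/
noncomputable def children (ih : Bool → ℕ → ℕ → ℕ → ℕ → ℕ → Bool) (n : ℕ) (sym : Bool)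
    (k Ta Tb F W x y : ℕ) : Bool :=
  Bool.rec
    (withOrbit k Ta Tb W x y fun O => Bool.rec false
      (child ih n (and sym (Nat.beq x y)) k Ta Tb F x y 1
        (family O k Ta Tb F x y 1 (elems W (Nat.pow 2 k))))
      (child ih n (and sym (Nat.beq x y)) k Ta Tb F x y 0
        (family O k Ta Tb F x y 0 (elems W (Nat.pow 2 k)))))
    true (and sym (Nat.ble (Nat.succ y) x))

/-- Check that all extensions of a `k`-state automaton by `n` states generate at most 34 sets;
if `sym` then the two letters act equally so far and may be exchanged. -/
noncomputable def search (n : ℕ) : Bool → ℕ → ℕ → ℕ → ℕ → ℕ → Bool :=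
  Nat.rec (fun _ _ _ _ _ _ => false)
    (fun n ih sym k Ta Tb F W => force k fun k => force Ta fun Ta => force Tb fun Tb =>
      force F fun F => force W fun W =>
        allBelow (fun x => allBelow (children ih n sym k Ta Tb F W x) (Nat.succ k)) (Nat.succ k)) n

theorem force_eq (n : ℕ) (f : ℕ → Bool) : force n f = f n := by cases n <;> rfl

theorem beq_of_eq {m n : ℕ} (h : m = n) : Nat.beq m n = true := h ▸ Nat.beq_refl m

theorem beq_of_ne {m n : ℕ} (h : m ≠ n) : Nat.beq m n = false :=
  Bool.eq_false_iff.mpr (mt Nat.eq_of_beq_eq_true h)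

theorem bit_eq (m i : ℕ) : bit m i = (m.testBit i).toNat := by
  rw [Nat.toNat_testBit]
  change (m >>> i) &&& 1 = _
  rw [Nat.and_one_is_mod, Nat.shiftRight_eq_div_pow]

theorem allBelow_iff (p : ℕ → Bool) (n : ℕ) : allBelow p n = true ↔ ∀ m < n, p m = true := by
  induction n with
  | zero => simp [allBelow]
  | succ n ih =>
    have : allBelow p (n + 1) = (p n && allBelow p n) := by
      change Bool.rec (motive := fun _ => Bool) false (allBelow p n) (p n) = _
      cases p n <;> rfl
    rw [this, Bool.and_eq_true, ih, Nat.forall_lt_succ_right, and_comm]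

theorem mem_elems (W n S : ℕ) : S ∈ elems W n ↔ S < n ∧ W.testBit S = true := by
  induction n with
  | zero => simp [elems]
  | succ n ih =>
    have h : elems W (n + 1) = bif W.testBit n then n :: elems W n else elems W n := by
      change Bool.rec (motive := fun _ => List ℕ) (elems W n) (n :: elems W n)
        (Nat.beq (bit W n) 1) = _
      rw [bit_eq]
      cases W.testBit n <;> rfl
    rw [h]
    cases hn : W.testBit n <;> simp only [cond_true, cond_false, List.mem_cons, ih] <;> grind

/-! ### Counting nonzero digits -/

/-- The sum of the last `n` digits of `m` in base `b`. -/
def digitSum (b : ℕ) : ℕ → ℕ → ℕ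
  | 0, _ => 0
  | n + 1, m => m % b + digitSum b n (m / b)

/-- The number with `n` digits `2 ^ w - 1` in base `4 ^ w`. -/
def evenMask (w : ℕ) : ℕ → ℕ
  | 0 => 0
  | n + 1 => (2 ^ w - 1) + 4 ^ w * evenMask w n

theorem digitSum_two (n m : ℕ) :
    digitSum 2 n m = ((Finset.range n).filter fun i => m.testBit i).card := by
  rw [Finset.card_filter]
  induction n generalizing m with
  | zero => rfl
  | succ n ih =>
    rw [digitSum, ih, Finset.sum_range_succ', add_comm]
    simp only [Nat.testBit_succ, Nat.testBit_zero]
    congr 1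
    rcases Nat.mod_two_eq_zero_or_one m with h | h <;> simp [h]

theorem and_evenMask_succ (w n m : ℕ) :
    m &&& evenMask w (n + 1) = m % 2 ^ w + 4 ^ w * ((m / 4 ^ w) &&& evenMask w n) := by
  have h4 : 4 ^ w = 2 ^ (2 * w) := by norm_num [pow_mul]
  have hlt : 2 ^ w - 1 < 2 ^ (2 * w) :=
    lt_of_lt_of_le (Nat.sub_lt (by positivity) one_pos) (Nat.pow_le_pow_right two_pos (by omega))
  rw [evenMask, h4, ← Nat.mod_add_div (m &&& _) (2 ^ (2 * w)), Nat.and_mod_two_pow,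
    Nat.and_div_two_pow, Nat.add_mul_mod_self_left, Nat.mod_eq_of_lt hlt,
    Nat.add_mul_div_left _ _ (by positivity), Nat.div_eq_of_lt hlt, zero_add,
    Nat.and_two_pow_sub_one_eq_mod, Nat.mod_mod_of_dvd _ (pow_dvd_pow 2 (by omega))]

theorem addPairs_succ (w n m : ℕ) : addPairs w (evenMask w (n + 1)) m =
    (m % 2 ^ w + m / 2 ^ w % 2 ^ w) + 4 ^ w * addPairs w (evenMask w n) (m / 4 ^ w) := by
  change (m &&& _) + ((m >>> w) &&& _) = _ + _ * ((m / 4 ^ w &&& _) + ((m / 4 ^ w) >>> w &&& _))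
  rw [and_evenMask_succ, and_evenMask_succ, Nat.shiftRight_eq_div_pow, Nat.shiftRight_eq_div_pow,
    Nat.div_div_eq_div_mul, Nat.div_div_eq_div_mul, mul_comm (2 ^ w) (4 ^ w)]
  ring

theorem add_mod_lt {w : ℕ} (hw : 1 ≤ w) (m : ℕ) : m % 2 ^ w + m / 2 ^ w % 2 ^ w < 4 ^ w := by
  have h2 : 2 ≤ 2 ^ w := by simpa using Nat.pow_le_pow_right two_pos hw
  have h4 : 4 ^ w = 2 ^ w * 2 ^ w := by norm_num [← mul_pow]
  have h1 := Nat.mod_lt m (y := 2 ^ w) (by positivity)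
  have h3 := Nat.mod_lt (m / 2 ^ w) (y := 2 ^ w) (by positivity)
  nlinarith

theorem digitSum_addPairs {w : ℕ} (hw : 1 ≤ w) (n m : ℕ) :
    digitSum (4 ^ w) n (addPairs w (evenMask w n) m) = digitSum (2 ^ w) (2 * n) m := by
  induction n generalizing m with
  | zero => rfl
  | succ n ih =>
    have h := add_mod_lt hw m
    rw [addPairs_succ, digitSum, Nat.add_mul_mod_self_left, Nat.mod_eq_of_lt h,
      Nat.add_mul_div_left _ _ (by positivity), Nat.div_eq_of_lt h, zero_add, ih, mul_add_one,
      digitSum, digitSum, Nat.div_div_eq_div_mul, ← mul_pow, add_assoc]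
    norm_num

theorem addPairs_lt {w : ℕ} (hw : 1 ≤ w) (n m : ℕ) :
    addPairs w (evenMask w n) m < (4 ^ w) ^ n := by
  induction n generalizing m with
  | zero =>
    change (m &&& 0) + ((m >>> w) &&& 0) < _
    simp
  | succ n ih =>
    rw [addPairs_succ, pow_succ]
    have := Nat.mul_le_mul_left (4 ^ w) (ih (m / 4 ^ w))
    have := add_mod_lt hw m
    rw [mul_comm _ (4 ^ w)]
    lia

theorem digitSum_modEq (b n m : ℕ) (hm : m < (b + 1) ^ n) :
    digitSum (b + 1) n m ≡ m [MOD b] := by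
  induction n generalizing m with
  | zero => obtain rfl : m = 0 := by simpa using hm
            rfl
  | succ n ih =>
    have h : m / (b + 1) < (b + 1) ^ n := by
      rw [Nat.div_lt_iff_lt_mul (by omega), ← pow_succ]
      exact hm
    have hb : (b + 1) * (m / (b + 1)) ≡ m / (b + 1) [MOD b] := by
      simp [Nat.ModEq, add_mul]
    calc m % (b + 1) + digitSum (b + 1) n (m / (b + 1))
        ≡ m % (b + 1) + (b + 1) * (m / (b + 1)) [MOD b] :=
          Nat.ModEq.add_left _ ((ih _ h).trans hb.symm)
      _ = m := Nat.mod_add_div _ _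

theorem popCount_eq (m : ℕ) :
    popCount m = ((Finset.range 128).filter fun i => m.testBit i).card := by
  have h1 := digitSum_addPairs (w := 1) (by norm_num) 64 m
  have h2 := digitSum_addPairs (w := 2) (by norm_num) 32 (addPairs 1 (evenMask 1 64) m)
  have h4 := digitSum_addPairs (w := 4) (by norm_num) 16
    (addPairs 2 (evenMask 2 32) (addPairs 1 (evenMask 1 64) m))
  have hmod := digitSum_modEq 255 16 _ (addPairs_lt (w := 4) (by norm_num) 16
    (addPairs 2 (evenMask 2 32) (addPairs 1 (evenMask 1 64) m)))
  have hcard : ((Finset.range 128).filter fun i => m.testBit i).card < 255 :=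
    (Finset.card_filter_le _ _).trans_lt (by simp)
  rw [← digitSum_two] at hcard ⊢
  norm_num at h1 h2 h4 hmod
  rw [h4, h2, h1] at hmod
  rw [← Nat.mod_eq_of_lt hcard, hmod]
  rfl

/-! ### Tables of preimages -/

/-- The preimage of `S` under `X`, restricted to the states below `k`. -/
def pre (k : ℕ) (X : ℕ → ℕ) (S : ℕ) : ℕ := Nat.ofBits fun i : Fin k => S.testBit (X i)

theorem testBit_pre (k : ℕ) (X : ℕ → ℕ) (S i : ℕ) :
    (pre k X S).testBit i = (decide (i < k) && S.testBit (X i)) := by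
  by_cases h : i < k
  · simp [pre, Nat.testBit_ofBits_lt _ _ h, h]
  · simp [pre, Nat.testBit_ofBits_ge _ _ (not_lt.mp h), h]

theorem pre_lt (k : ℕ) (X : ℕ → ℕ) (S : ℕ) : pre k X S < 2 ^ k := Nat.ofBits_lt_two_pow _

theorem testBit_add_mul {k u : ℕ} (hu : u < 2 ^ k) (b i : ℕ) :
    (u + b * 2 ^ k).testBit i = if i < k then u.testBit i else b.testBit (i - k) := by
  rw [add_comm, mul_comm, Nat.testBit_two_pow_mul_add _ hu]

/-- The bytes of `T` are the preimages under `X` of the sets of states below 7. -/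
def IsTable (k : ℕ) (X : ℕ → ℕ) (T : ℕ) : Prop :=
  ∀ j < 1024, T.testBit j = (decide (j % 8 < k) && (j / 8).testBit (X (j % 8)))

theorem IsTable.lookup_eq {k : ℕ} {X : ℕ → ℕ} {T S : ℕ} (hT : IsTable k X T) (hk : k ≤ 8)
    (hS : S < 128) : lookup T S = pre k X S := by
  refine Nat.eq_of_testBit_eq fun i => ?_
  change ((T >>> (8 * S)) &&& (2 ^ 8 - 1)).testBit i = _
  rw [Nat.and_two_pow_sub_one_eq_mod, Nat.testBit_mod_two_pow, Nat.testBit_shiftRight, testBit_pre]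
  by_cases hi : i < 8
  · rw [hT _ (by omega), show (8 * S + i) % 8 = i by omega, show (8 * S + i) / 8 = S by omega]
    simp [hi]
  · simp [hi, show ¬ i < k by omega]

set_option maxRecDepth 20000 in
theorem testBit_column :
    ∀ x < 7, ∀ j < 1024, (column x).testBit j = (j % 8 == 0 && (j / 8).testBit x) := by
  decide +kernel

theorem IsTable.extend {k : ℕ} {X : ℕ → ℕ} {T : ℕ} (hT : IsTable k X T) (hk : k < 7)
    (hX : X k < 7) : IsTable (k + 1) X (extend T k (X k)) := by
  intro j hj
  change (T ||| (column (X k) <<< k)).testBit j = _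
  rw [Nat.testBit_or, Nat.testBit_shiftLeft, hT j hj, testBit_column _ hX _ (by omega)]
  rcases lt_trichotomy (j % 8) k with h | h | h
  · have : ¬ (k ≤ j ∧ (j - k) % 8 = 0) := by omega
    have : (decide (k ≤ j) && ((j - k) % 8 == 0 && ((j - k) / 8).testBit (X k))) = false := by
      grind
    simp [this, h, show j % 8 < k + 1 by omega]
  · simp [h, show k ≤ j by omega, show (j - k) % 8 = 0 by omega,
      show (j - k) / 8 = j / 8 by omega]
  · have : ¬ (k ≤ j ∧ (j - k) % 8 = 0) := by omega
    have : (decide (k ≤ j) && ((j - k) % 8 == 0 && ((j - k) / 8).testBit (X k))) = false := by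
      grind
    simp [this, show ¬ j % 8 < k by omega, show ¬ j % 8 < k + 1 by omega]

theorem isTable_one {X : ℕ → ℕ} (hX : ∀ i, X i ≤ i) : IsTable 1 X (column 0) := by
  intro j hj
  rw [testBit_column 0 (by norm_num) j hj]
  by_cases h : j % 8 = 0
  · simp [h, Nat.le_zero.mp (hX 0)]
  · simp [h]

/-! ### Families closed under preimages -/

/-- The family `W` contains `F` and is closed under preimages on the states below `k`. -/
structure IsFamily (k : ℕ) (X Y : ℕ → ℕ) (F W : ℕ) : Prop where
  start : W.testBit F = true
  lt : ∀ S, W.testBit S = true → S < 2 ^ k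
  left : ∀ S, W.testBit S = true → W.testBit (pre k X S) = true
  right : ∀ S, W.testBit S = true → W.testBit (pre k Y S) = true

theorem IsFamily.swap {k : ℕ} {X Y : ℕ → ℕ} {F W : ℕ} (h : IsFamily k X Y F W) :
    IsFamily k Y X F W := ⟨h.start, h.lt, h.right, h.left⟩

/-- The operator `O` maps members `S` of `W` to subfamilies of `W` containing `S` that are closed
under those letters that loop at the state `k`. -/
structure IsClosureOp (k : ℕ) (X Y : ℕ → ℕ) (W : ℕ) (O : ℕ → ℕ) : Prop where
  self : ∀ S, W.testBit S = true → (O S).testBit S = true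
  sub : ∀ S, W.testBit S = true → ∀ v, (O S).testBit v = true → W.testBit v = true
  left : X k = k → ∀ S, W.testBit S = true → ∀ v, (O S).testBit v = true →
    (O S).testBit (pre k X v) = true
  right : Y k = k → ∀ S, W.testBit S = true → ∀ v, (O S).testBit v = true →
    (O S).testBit (pre k Y v) = true

theorem orbit_succ (T W n S : ℕ) : orbit T W (n + 1) S =
    if lookup T S = S then 1 <<< S else (1 <<< S) ||| orbit T W n (lookup T S) := by
  change Bool.rec (motive := fun _ => ℕ) _ _ (Nat.beq (lookup T S) S) = _
  split_ifs with h
  · rw [beq_of_eq h]; rfl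
  · rw [beq_of_ne h]; rfl

theorem testBit_one_shiftLeft (S v : ℕ) : (1 <<< S).testBit v = decide (S = v) := by
  rw [Nat.one_shiftLeft, Nat.testBit_two_pow]

theorem orbit_spec {k : ℕ} {X : ℕ → ℕ} {T W : ℕ} (hk : k ≤ 7) (hT : IsTable k X T)
    (hlt : ∀ S, W.testBit S = true → S < 2 ^ k)
    (hW : ∀ S, W.testBit S = true → W.testBit (pre k X S) = true) (n S : ℕ)
    (hS : W.testBit S = true) : (orbit T W n S).testBit S = true ∧
      ∀ v, (orbit T W n S).testBit v = true →
        W.testBit v = true ∧ (orbit T W n S).testBit (pre k X v) = true := by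
  induction n generalizing S with
  | zero => exact ⟨hS, fun v hv => ⟨hv, hW v hv⟩⟩
  | succ n ih =>
    have hS' : S < 128 := (hlt S hS).trans_le (Nat.pow_le_pow_right two_pos hk)
    rw [orbit_succ, hT.lookup_eq (by omega) hS']
    split_ifs with h
    · simp only [testBit_one_shiftLeft, decide_eq_true_eq, true_and]
      rintro v rfl
      exact ⟨hS, h.symm⟩
    · obtain ⟨h1, h2⟩ := ih _ (hW S hS)
      simp only [Nat.testBit_or, testBit_one_shiftLeft, Bool.or_eq_true, decide_eq_true_eq,
        true_or, true_and]
      rintro v (rfl | hv)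
      · exact ⟨hS, Or.inr h1⟩
      · exact ⟨(h2 v hv).1, Or.inr (h2 v hv).2⟩

theorem withOrbit_spec {k : ℕ} {X Y : ℕ → ℕ} {Ta Tb F W : ℕ} (hk : k ≤ 7) (hTa : IsTable k X Ta)
    (hTb : IsTable k Y Tb) (hW : IsFamily k X Y F W) (g : (ℕ → ℕ) → Bool)
    (hg : withOrbit k Ta Tb W (X k) (Y k) g = true) :
    ∃ O, IsClosureOp k X Y W O ∧ g O = true := by
  have hX := orbit_spec hk hTa hW.lt hW.left 8
  have hY := orbit_spec hk hTb hW.lt hW.right 8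
  rw [withOrbit] at hg
  by_cases hx : X k = k <;> by_cases hy : Y k = k
  · rw [beq_of_eq hx, beq_of_eq hy] at hg
    exact ⟨_, ⟨fun S h => h, fun _ _ _ h => h, fun _ _ _ => hW.left, fun _ _ _ => hW.right⟩, hg⟩
  · rw [beq_of_eq hx, beq_of_ne hy] at hg
    exact ⟨_, ⟨fun S h => (hX S h).1, fun S h v hv => ((hX S h).2 v hv).1,
      fun _ S h v hv => ((hX S h).2 v hv).2, fun h => absurd h hy⟩, hg⟩
  · rw [beq_of_ne hx, beq_of_eq hy] at hg
    exact ⟨_, ⟨fun S h => (hY S h).1, fun S h v hv => ((hY S h).2 v hv).1,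
      fun h => absurd h hx, fun _ S h v hv => ((hY S h).2 v hv).2⟩, hg⟩
  · rw [beq_of_ne hx, beq_of_ne hy] at hg
    refine ⟨_, ⟨fun S _ => ?_, fun S h v hv => ?_, fun h => absurd h hx, fun h => absurd h hy⟩, hg⟩
    · exact (testBit_one_shiftLeft S S).trans (by simp)
    · rw [← of_decide_eq_true ((testBit_one_shiftLeft S v).symm.trans hv)]
      exact h

theorem testBit_edges {k : ℕ} {X : ℕ → ℕ} {T : ℕ} (hk : k ≤ 7) (hT : IsTable k X T) (O : ℕ → ℕ)
    (x : ℕ) (L : List ℕ) (hL : ∀ S ∈ L, S < 2 ^ k) (v : ℕ) :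
    (edges O T k x L).testBit v = true ↔ x ≠ k ∧ ∃ S ∈ L, ∃ u, (O (pre k X S)).testBit u = true ∧
      v = u + (S.testBit x).toNat * 2 ^ k := by
  rw [edges]
  by_cases hx : x = k
  · rw [beq_of_eq hx]
    simp [hx]
  rw [beq_of_ne hx]
  simp only [ne_eq, hx, not_false_eq_true, true_and]
  induction L with
  | nil => simp
  | cons S L ih =>
    have hS : S < 128 := (hL S (by simp)).trans_le (Nat.pow_le_pow_right two_pos hk)
    rw [List.exists_mem_cons_iff, ← ih fun S hS => hL S (List.mem_cons_of_mem _ hS), or_comm]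
    change (_ ||| (O (lookup T S) <<< (bit S x * 2 ^ k))).testBit v = true ↔ _
    rw [hT.lookup_eq (by omega) hS, bit_eq, Nat.testBit_or, Bool.or_eq_true,
      Nat.testBit_shiftLeft, Bool.and_eq_true, decide_eq_true_eq]
    refine or_congr Iff.rfl ⟨fun ⟨h, h'⟩ => ⟨_, h', by omega⟩, ?_⟩
    rintro ⟨u, hu, rfl⟩
    simpa using hu

theorem testBit_family {k : ℕ} {X Y : ℕ → ℕ} {Ta Tb F W : ℕ} (hk : k ≤ 7) (hTa : IsTable k X Ta)
    (hTb : IsTable k Y Tb) (hW : ∀ S, W.testBit S = true → S < 2 ^ k) (O : ℕ → ℕ)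
    (x y f v : ℕ) :
    (family O k Ta Tb F x y f (elems W (2 ^ k))).testBit v = true ↔
      (∃ u, (O F).testBit u = true ∧ v = u + f * 2 ^ k) ∨
      (x ≠ k ∧ ∃ S, W.testBit S = true ∧ ∃ u, (O (pre k X S)).testBit u = true ∧
        v = u + (S.testBit x).toNat * 2 ^ k) ∨
      (y ≠ k ∧ ∃ S, W.testBit S = true ∧ ∃ u, (O (pre k Y S)).testBit u = true ∧
        v = u + (S.testBit y).toNat * 2 ^ k) := by
  have hmem (S : ℕ) : S ∈ elems W (2 ^ k) ↔ W.testBit S = true := by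
    rw [mem_elems]
    exact ⟨And.right, fun h => ⟨hW S h, h⟩⟩
  change ((O F <<< (f * 2 ^ k)) ||| (edges _ _ _ _ _ ||| edges _ _ _ _ _)).testBit v = true ↔ _
  rw [Nat.testBit_or, Nat.testBit_or, Bool.or_eq_true, Bool.or_eq_true,
    testBit_edges hk hTa _ _ _ fun S hS => hW S ((hmem S).mp hS),
    testBit_edges hk hTb _ _ _ fun S hS => hW S ((hmem S).mp hS)]
  simp only [hmem]
  refine or_congr ?_ Iff.rfl
  rw [Nat.testBit_shiftLeft, Bool.and_eq_true, decide_eq_true_eq]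
  refine ⟨fun ⟨h, h'⟩ => ⟨_, h', by omega⟩, ?_⟩
  rintro ⟨u, hu, rfl⟩
  simpa using hu

theorem pre_succ {k : ℕ} {X : ℕ → ℕ} (hX : ∀ i, X i ≤ i) {u : ℕ} (hu : u < 2 ^ k) (b : ℕ) :
    pre (k + 1) X (u + b * 2 ^ k) =
      pre k X u + ((u + b * 2 ^ k).testBit (X k)).toNat * 2 ^ k := by
  refine Nat.eq_of_testBit_eq fun i => ?_
  rw [testBit_add_mul (pre_lt k X u), testBit_pre, testBit_pre]
  rcases lt_trichotomy i k with h | rfl | h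
  · have := hX i
    simp [h, show i < k + 1 by omega, testBit_add_mul hu, show X i < k by omega]
  · cases (u + b * 2 ^ i).testBit (X i) <;> simp
  · simp only [show ¬ i < k by omega, show ¬ i < k + 1 by omega, if_false, decide_false,
      Bool.false_and]
    obtain ⟨j, hj⟩ : ∃ j, i - k = j + 1 := ⟨i - k - 1, by omega⟩
    cases (u + b * 2 ^ k).testBit (X k) <;> simp [hj, Nat.testBit_succ]

theorem IsFamily.family {k : ℕ} {X Y : ℕ → ℕ} {Ta Tb F W f : ℕ} {O : ℕ → ℕ} (hk : k ≤ 7)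
    (hX : ∀ i, X i ≤ i) (hY : ∀ i, Y i ≤ i) (hTa : IsTable k X Ta) (hTb : IsTable k Y Tb)
    (hW : IsFamily k X Y F W) (hO : IsClosureOp k X Y W O) (hf : f ≤ 1) :
    IsFamily (k + 1) X Y (F + f * 2 ^ k)
      (family O k Ta Tb F (X k) (Y k) f (elems W (2 ^ k))) := by
  have hZ := testBit_family (F := F) hk hTa hTb hW.lt O (X k) (Y k) f
  set Z := PreimageSearch.family O k Ta Tb F (X k) (Y k) f (elems W (2 ^ k))
  have hpiece (v : ℕ) (hv : Z.testBit v = true) : ∃ S b u, W.testBit S = true ∧ b ≤ 1 ∧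
      (O S).testBit u = true ∧ v = u + b * 2 ^ k ∧
      ∀ u', (O S).testBit u' = true → Z.testBit (u' + b * 2 ^ k) = true := by
    rcases (hZ v).mp hv with ⟨u, hu, rfl⟩ | ⟨hx, S, hS, u, hu, rfl⟩ | ⟨hy, S, hS, u, hu, rfl⟩
    · exact ⟨F, f, u, hW.start, hf, hu, rfl, fun u' hu' => (hZ _).mpr (Or.inl ⟨u', hu', rfl⟩)⟩
    · exact ⟨_, _, u, hW.left S hS, Bool.toNat_le _, hu, rfl,
        fun u' hu' => (hZ _).mpr (Or.inr (Or.inl ⟨hx, S, hS, u', hu', rfl⟩))⟩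
    · exact ⟨_, _, u, hW.right S hS, Bool.toNat_le _, hu, rfl,
        fun u' hu' => (hZ _).mpr (Or.inr (Or.inr ⟨hy, S, hS, u', hu', rfl⟩))⟩
  have htop (b : ℕ) (hb : b ≤ 1) : (b.testBit 0).toNat = b := by interval_cases b <;> rfl
  refine ⟨(hZ _).mpr (Or.inl ⟨F, hO.self F hW.start, rfl⟩), fun v hv => ?_, fun v hv => ?_,
    fun v hv => ?_⟩
  all_goals
    obtain ⟨S, b, u, hS, hb, hu, rfl, hpiece⟩ := hpiece v hv
    have hWu := hO.sub S hS u hu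
    have hlt := hW.lt u hWu
  · rw [pow_succ]
    nlinarith
  · rw [pre_succ hX hlt]
    by_cases hx : X k = k
    · rw [hx, testBit_add_mul hlt, if_neg (lt_irrefl k), Nat.sub_self, htop b hb]
      exact hpiece _ (hO.left hx S hS u hu)
    · rw [testBit_add_mul hlt, if_pos (lt_of_le_of_ne (hX k) hx)]
      exact (hZ _).mpr (Or.inr (Or.inl ⟨hx, u, hWu, _, hO.self _ (hW.left u hWu), rfl⟩))
  · rw [pre_succ hY hlt]
    by_cases hy : Y k = k
    · rw [hy, testBit_add_mul hlt, if_neg (lt_irrefl k), Nat.sub_self, htop b hb]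
      exact hpiece _ (hO.right hy S hS u hu)
    · rw [testBit_add_mul hlt, if_pos (lt_of_le_of_ne (hY k) hy)]
      exact (hZ _).mpr (Or.inr (Or.inr ⟨hy, u, hWu, _, hO.self _ (hW.right u hWu), rfl⟩))

/-! ### Correctness of the search -/

/-- At most `N` sets are generated from `G` by taking preimages under `X` and `Y` on 7 states. -/
def Bounded (N : ℕ) (X Y : ℕ → ℕ) (G : ℕ) : Prop :=
  ∃ C : Finset ℕ, G ∈ C ∧ (∀ S ∈ C, pre 7 X S ∈ C ∧ pre 7 Y S ∈ C) ∧ C.card ≤ N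

theorem Bounded.swap {N : ℕ} {X Y : ℕ → ℕ} {G : ℕ} : Bounded N X Y G → Bounded N Y X G :=
  fun ⟨C, hG, hC, hN⟩ => ⟨C, hG, fun S hS => (hC S hS).symm, hN⟩

theorem pre_mod {k : ℕ} (hk : k ≤ 7) {X : ℕ → ℕ} (hX : ∀ i, X i ≤ i) (S : ℕ) :
    pre 7 X S % 2 ^ k = pre k X (S % 2 ^ k) := by
  refine Nat.eq_of_testBit_eq fun i => ?_
  rw [Nat.testBit_mod_two_pow, testBit_pre, testBit_pre, Nat.testBit_mod_two_pow]
  by_cases h : i < k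
  · have := hX i
    simp [h, show i < 7 by omega, show X i < k by omega]
  · simp [h]

theorem IsFamily.bounded {k : ℕ} {X Y : ℕ → ℕ} {G W N : ℕ} (hk : k ≤ 7) (hX : ∀ i, X i ≤ i)
    (hY : ∀ i, Y i ≤ i) (hG : G < 128) (hW : IsFamily k X Y (G % 2 ^ k) W)
    (hN : popCount W * 2 ^ (7 - k) ≤ N) : Bounded N X Y G := by
  have hle : 2 ^ k ≤ 128 := Nat.pow_le_pow_right two_pos hk
  refine ⟨(Finset.range 128).filter fun S => W.testBit (S % 2 ^ k), ?_, fun S hS => ?_,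
    le_trans ?_ hN⟩
  · simpa [hG] using hW.start
  · simp only [Finset.mem_filter, Finset.mem_range, pre_mod hk hX, pre_mod hk hY] at hS ⊢
    exact ⟨⟨pre_lt 7 X S, hW.left _ hS.2⟩, ⟨pre_lt 7 Y S, hW.right _ hS.2⟩⟩
  · rw [popCount_eq, ← Finset.card_range (2 ^ (7 - k)), ← Finset.card_product]
    refine Finset.card_le_card_of_injOn (fun S => (S % 2 ^ k, S / 2 ^ k)) (fun S hS => ?_) ?_
    · simp only [Finset.coe_filter, Finset.mem_range, Set.mem_ofPred_eq, Finset.coe_product,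
        Set.mem_prod, Finset.mem_coe] at hS ⊢
      refine ⟨⟨(Nat.mod_lt _ (by positivity)).trans_le hle, hS.2⟩, ?_⟩
      rw [Nat.div_lt_iff_lt_mul (by positivity), ← pow_add, Nat.sub_add_cancel hk]
      exact hS.1
    · intro S _ S' _ h
      simp only [Prod.mk.injEq] at h
      rw [← Nat.mod_add_div S (2 ^ k), ← Nat.mod_add_div S' (2 ^ k), h.1, h.2]

theorem search_succ (n : ℕ) (sym : Bool) (k Ta Tb F W : ℕ) :
    search (n + 1) sym k Ta Tb F W = true ↔
      ∀ x ≤ k, ∀ y ≤ k, children (search n) n sym k Ta Tb F W x y = true := by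
  change force k (fun k => force Ta fun Ta => force Tb fun Tb => force F fun F => force W fun W =>
    allBelow (fun x => allBelow (children (search n) n sym k Ta Tb F W x) (k + 1)) (k + 1)) = true
    ↔ _
  simp only [force_eq, allBelow_iff, Nat.lt_succ_iff]

theorem and_of_rec {a b : Bool} (h : Bool.rec (motive := fun _ => Bool) false a b = true) :
    b = true ∧ a = true := by
  cases b
  · cases h
  · exact ⟨rfl, h⟩

theorem withOrbit_mono {k Ta Tb W x y : ℕ} {g g' : (ℕ → ℕ) → Bool}
    (hg : ∀ O, g O = true → g' O = true) (h : withOrbit k Ta Tb W x y g = true) :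
    withOrbit k Ta Tb W x y g' = true := by
  rw [withOrbit] at h ⊢
  cases hx : Nat.beq x k <;> cases hy : Nat.beq y k <;> rw [hx, hy] at h <;> exact hg _ h

theorem child_spec {ih : Bool → ℕ → ℕ → ℕ → ℕ → ℕ → Bool} {n : ℕ} {sym : Bool}
    {k Ta Tb F x y f Z : ℕ} (h : child ih n sym k Ta Tb F x y f Z = true) :
    popCount Z ≤ 34 / 2 ^ n ∨
      ih sym (k + 1) (extend Ta k x) (extend Tb k y) (F + f * 2 ^ k) Z = true := by
  change Bool.rec (motive := fun _ => Bool) _ true (Nat.ble (popCount Z) (34 / 2 ^ n)) = true at h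
  cases hb : Nat.ble (popCount Z) (34 / 2 ^ n) with
  | true => exact Or.inl (Nat.le_of_ble_eq_true hb)
  | false => rw [hb] at h; exact Or.inr h

theorem children_spec {ih : Bool → ℕ → ℕ → ℕ → ℕ → ℕ → Bool} {n : ℕ} {sym : Bool}
    {k Ta Tb F W x y f : ℕ} (h : children ih n sym k Ta Tb F W x y = true)
    (hsym : sym = true → x ≤ y) (hf : f ≤ 1) :
    withOrbit k Ta Tb W x y (fun O => child ih n (sym && Nat.beq x y) k Ta Tb F x y f
      (family O k Ta Tb F x y f (elems W (2 ^ k)))) = true := by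
  have hb : (sym && Nat.ble (Nat.succ y) x) = false := by
    cases sym
    · rfl
    · refine Bool.eq_false_iff.mpr fun hb => ?_
      have := Nat.le_of_ble_eq_true hb
      have := hsym rfl
      omega
  rw [children] at h
  change Bool.rec (motive := fun _ => Bool) _ true (sym && Nat.ble (Nat.succ y) x) = true at h
  rw [hb] at h
  refine withOrbit_mono (fun O hO => ?_) h
  have hO : Bool.rec (motive := fun _ => Bool) _ _ _ = true := hO
  obtain ⟨h0, h1⟩ := and_of_rec hO
  interval_cases f
  exacts [h0, h1]

theorem bounded_of_search (n : ℕ) (sym : Bool) (k Ta Tb F W G : ℕ) (X Y : ℕ → ℕ)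
    (hn : k + n = 7) (hX : ∀ i, X i ≤ i) (hY : ∀ i, Y i ≤ i) (hTa : IsTable k X Ta)
    (hTb : IsTable k Y Tb) (hG : G < 128) (hF : F = G % 2 ^ k) (hW : IsFamily k X Y F W)
    (hsym : sym = true → Ta = Tb) (h : search n sym k Ta Tb F W = true) : Bounded 34 X Y G := by
  induction n generalizing sym k Ta Tb F W X Y with
  | zero => cases h
  | succ n ih =>
    wlog hxy : sym = true → X k ≤ Y k generalizing X Y Ta Tb
    · push Not at hxy
      obtain rfl := hsym hxy.1
      exact (this Ta Ta Y X hY hX hTb hTa hW.swap (fun _ => rfl) h fun _ => hxy.2.le).swap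
    have hc := (search_succ ..).mp h (X k) (hX k) (Y k) (hY k)
    obtain ⟨O, hO, hc⟩ := withOrbit_spec (by omega) hTa hTb hW _
      (children_spec (f := (G.testBit k).toNat) hc hxy (Bool.toNat_le _))
    have hZ := hW.family (by omega) hX hY hTa hTb hO (Bool.toNat_le (G.testBit k))
    have hG' : F + (G.testBit k).toNat * 2 ^ k = G % 2 ^ (k + 1) := by
      rw [hF, Nat.mod_pow_succ, Nat.toNat_testBit, mul_comm]
    rw [hG'] at hZ
    rcases child_spec hc with hc | hc
    · refine hZ.bounded (by omega) hX hY hG ?_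
      rw [show 7 - (k + 1) = n by omega]
      exact (Nat.le_div_iff_mul_le (by positivity)).mp hc
    · rw [hG'] at hc
      have hlt (X : ℕ → ℕ) (hX : ∀ i, X i ≤ i) : X k < 7 := (hX k).trans_lt (by omega)
      refine ih _ _ _ _ _ _ X Y (by omega) hX hY (hTa.extend (by omega) (hlt X hX))
        (hTb.extend (by omega) (hlt Y hY)) rfl hZ (fun hs => ?_) hc
      rw [Bool.and_eq_true] at hs
      rw [hsym hs.1, Nat.eq_of_beq_eq_true hs.2]

/-- The search below the 2-state automaton with an identity letter, the other letter constantly `0`,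
and state `1` accepting, with successor `x` of the new state under the constant letter. -/
noncomputable def searchBranch (x : ℕ) : Bool :=
  allBelow (children (search 4) 4 false 2 (extend (column 0) 1 0) (extend (column 0) 1 1) 2 5 x) 3

set_option maxRecDepth 100000 in
theorem searchBranch_zero : searchBranch 0 = true := by
  decide +kernel

set_option maxRecDepth 100000 in
theorem searchBranch_one : searchBranch 1 = true := by
  decide +kernel

set_option maxRecDepth 100000 in
theorem searchBranch_two : searchBranch 2 = true := by
  decide +kernel

theorem children_identity (ih : Bool → ℕ → ℕ → ℕ → ℕ → ℕ → Bool) :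
    children ih 5 true 1 (column 0) (column 0) 0 1 0 1 =
      ih false 2 (extend (column 0) 1 0) (extend (column 0) 1 1) 2 5 := by
  rfl

theorem search_eq_true : search 6 true 1 (column 0) (column 0) 0 1 = true := by
  rw [search_succ]
  intro x hx y hy
  by_cases hxy : x = 0 ∧ y = 1
  · obtain ⟨rfl, rfl⟩ := hxy
    rw [children_identity, search_succ]
    intro x hx y hy
    have h : searchBranch x = true := by
      interval_cases x
      exacts [searchBranch_zero, searchBranch_one, searchBranch_two]
    exact (allBelow_iff _ _).mp h y (Nat.lt_succ_of_le hy)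
  · interval_cases x <;> interval_cases y
    · decide +kernel
    · simp at hxy
    · decide +kernel
    · decide +kernel

theorem pre_compl (X : ℕ → ℕ) {S : ℕ} (hS : S < 128) (hX : ∀ i, X i ≤ i) :
    pre 7 X (127 - S) = 127 - pre 7 X S := by
  refine Nat.eq_of_testBit_eq fun i => ?_
  rw [show 127 - S = 2 ^ 7 - (S + 1) by omega,
    show 127 - pre 7 X S = 2 ^ 7 - (pre 7 X S + 1) by omega, testBit_pre,
    Nat.testBit_two_pow_sub_succ hS, Nat.testBit_two_pow_sub_succ (pre_lt 7 X S), testBit_pre]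
  by_cases h : i < 7
  · simp [h, show X i < 7 from (hX i).trans_lt h]
  · simp [h]

theorem bounded {X Y : ℕ → ℕ} (hX : ∀ i, X i ≤ i) (hY : ∀ i, Y i ≤ i) {G : ℕ} (hG : G < 128) :
    Bounded 34 X Y G := by
  wlog h0 : G % 2 = 0 generalizing G
  · obtain ⟨C, hGC, hC, hcard⟩ := this (G := 127 - G) (by omega) (by omega)
    refine ⟨(C.filter (· < 128)).image (127 - ·), ?_, fun S hS => ?_,
      Finset.card_image_le.trans ((Finset.card_filter_le _ _).trans hcard)⟩
    · exact Finset.mem_image.mpr ⟨127 - G, by simp [hGC]; omega, by omega⟩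
    · simp only [Finset.mem_image, Finset.mem_filter] at hS ⊢
      obtain ⟨S, ⟨hSC, hS⟩, rfl⟩ := hS
      exact ⟨⟨_, ⟨(hC S hSC).1, pre_lt 7 X S⟩, (pre_compl X hS hX).symm⟩,
        ⟨_, ⟨(hC S hSC).2, pre_lt 7 Y S⟩, (pre_compl Y hS hY).symm⟩⟩
  have h1 (S : ℕ) : Nat.testBit 1 S = true ↔ S = 0 := by
    rw [← pow_zero 2, Nat.testBit_two_pow]
    simp [eq_comm]
  have hpre (X : ℕ → ℕ) : pre 1 X 0 = 0 := by
    refine Nat.eq_of_testBit_eq fun i => ?_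
    simp [testBit_pre]
  refine bounded_of_search 6 true 1 _ _ 0 1 G X Y rfl hX hY (isTable_one hX) (isTable_one hY) hG
    h0.symm ⟨rfl, ?_, ?_, ?_⟩ (fun _ => rfl) search_eq_true
  all_goals simp [h1, hpre]

end PreimageSearch


/-! ### State complexity -/

theorem stateComplexity_le_card {α σ : Type} [Fintype σ] (M : DFA α σ) :
    stateComplexity M.accepts ≤ Fintype.card σ :=
  Nat.sInf_le ⟨M.reindex (Fintype.equivFin σ), by simp⟩

/-- Words that are pairwise inequivalent under the Nerode congruence bound the state complexity. -/
theorem card_le_stateComplexity {α ι : Type} [Fintype ι] {L : Language α} (hL : L.IsRegular)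
    (g : ι → List α) (hg : ∀ i j, (∀ v, g i ++ v ∈ L ↔ g j ++ v ∈ L) → i = j) :
    Fintype.card ι ≤ stateComplexity L := by
  obtain ⟨σ, _, M, rfl⟩ := hL
  have hne : {n : ℕ | ∃ M' : DFA α (Fin n), M'.accepts = M.accepts}.Nonempty :=
    ⟨_, M.reindex (Fintype.equivFin σ), by simp⟩
  obtain ⟨M', hM'⟩ := Nat.sInf_mem hne
  rw [← Fintype.card_fin (stateComplexity M.accepts)]
  refine Fintype.card_le_of_injective (fun i => M'.eval (g i)) fun i j hij => hg i j fun v => ?_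
  have hij : M'.eval (g i) = M'.eval (g j) := hij
  have happ (u : List α) : M'.eval (u ++ v) = M'.evalFrom (M'.eval u) v :=
    M'.evalFrom_of_append _ _ _
  rw [← hM', DFA.mem_accepts, DFA.mem_accepts, happ, happ, hij]

theorem DFA.MinimalDFA.stateComplexity_eq_s8 {α σ : Type} [Fintype σ] {M : DFA α σ}
    (hM : M.MinimalDFA) : stateComplexity M.accepts = Fintype.card σ := by
  refine le_antisymm (stateComplexity_le_card M) ?_
  choose g hg using hM.1
  refine card_le_stateComplexity ⟨σ, inferInstance, M, rfl⟩ g fun i j h => ?_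
  by_contra hij
  obtain ⟨w, hw⟩ := hM.2 i j hij
  have happ (i : σ) : M.eval (g i ++ w) = M.evalFrom i w := by
    rw [DFA.eval, DFA.evalFrom_of_append, hg]
  apply hw
  simpa only [DFA.mem_accepts, happ] using h w

theorem exists_monotone_equiv_fin {α : Type} [PartialOrder α] [hα : Fintype α] {n : ℕ}
    (h : Fintype.card α = n) : ∃ e : α ≃ Fin n, Monotone e :=
  let e := @Fintype.orderIsoFinOfCardEq (LinearExtension α) _ hα n h
  ⟨e.symm.toEquiv, fun _ _ hpq => e.symm.monotone (toLinearExtension.monotone hpq)⟩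

theorem DFA.PartiallyOrderedDFA.exists_equiv {α σ : Type} [Fintype σ] {M : DFA α σ}
    (hM : M.PartiallyOrderedDFA) {n : ℕ} (h : Fintype.card σ = n) :
    ∃ e : σ ≃ Fin n, ∀ q a, e (M.step q a) ≤ e q := by
  let P : PartialOrder σ :=
    { le := fun p q => ∃ w, M.evalFrom q w = p
      le_refl := fun p => ⟨[], rfl⟩
      le_trans := by
        rintro _ _ r ⟨u, rfl⟩ ⟨v, rfl⟩
        exact ⟨v ++ u, M.evalFrom_of_append _ _ _⟩
      le_antisymm := fun p q hpq hqp => hM p q hqp hpq }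
  obtain ⟨e, he⟩ := exists_monotone_equiv_fin h
  exact ⟨e, fun q a => he ⟨[a], rfl⟩⟩

/-- A family of sets of states that contains the accepting set and is closed under preimages carries
an automaton for the reverse language. -/
theorem stateComplexity_reverse_le_of_preimages {α σ : Type} (M : DFA α σ) (C : Finset (Set σ))
    (hacc : M.accept ∈ C) (hC : ∀ S ∈ C, ∀ a, (fun q => M.step q a) ⁻¹' S ∈ C) :
    stateComplexity M.accepts.reverse ≤ C.card := by
  let R : DFA α C :=
    { step := fun S a => ⟨(fun q => M.step q a) ⁻¹' S, hC S S.2 a⟩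
      start := ⟨M.accept, hacc⟩
      accept := {S | M.start ∈ S.1} }
  have hR (w : List α) (q : σ) : q ∈ (R.eval w).1 ↔ M.evalFrom q w.reverse ∈ M.accept := by
    induction w using List.reverseRecOn generalizing q with
    | nil => rfl
    | append_singleton w a ih =>
      rw [DFA.eval_append_singleton, List.reverse_append]
      exact ih (M.step q a)
  have hL : R.accepts = M.accepts.reverse := by
    ext w
    exact hR w M.start
  rw [← hL, ← Fintype.card_coe C]
  exact stateComplexity_le_card R

theorem DFA.PartiallyOrderedDFA.stateComplexity_reverse_le {σ : Type} [Fintype σ]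
    {M : DFA (Fin 2) σ} (hM : M.PartiallyOrderedDFA) (h : Fintype.card σ = 7) :
    stateComplexity M.accepts.reverse ≤ 34 := by
  classical
  obtain ⟨e, he⟩ := hM.exists_equiv h
  let X (a : Fin 2) (i : ℕ) : ℕ := if hi : i < 7 then e (M.step (e.symm ⟨i, hi⟩) a) else i
  have hX (a : Fin 2) (i : ℕ) : X a i ≤ i := by
    by_cases hi : i < 7
    · simpa [X, hi, Fin.le_def] using he (e.symm ⟨i, hi⟩) a
    · simp [X, hi]
  let states (S : ℕ) : Set σ := {q | S.testBit (e q) = true}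
  have hpre (a : Fin 2) (S : ℕ) :
      (fun q => M.step q a) ⁻¹' states S = states (PreimageSearch.pre 7 (X a) S) := by
    ext q
    simp [states, PreimageSearch.testBit_pre, X]
  obtain ⟨C, hG, hC, hcard⟩ := PreimageSearch.bounded (hX 0) (hX 1)
    (Nat.ofBits_lt_two_pow fun i : Fin 7 => decide (e.symm i ∈ M.accept))
  refine (stateComplexity_reverse_le_of_preimages M (C.image states) ?_ ?_).trans
    (Finset.card_image_le.trans hcard)
  · refine Finset.mem_image.mpr ⟨_, hG, ?_⟩
    ext q
    simp [states]
  · simp only [Finset.forall_mem_image]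
    intro S hS a
    rw [hpre]
    refine Finset.mem_image_of_mem _ ?_
    fin_cases a
    exacts [(hC S hS).1, (hC S hS).2]

theorem IsRTrivial.stateComplexity_reverse_le {L : Language (Fin 2)} (hL : IsRTrivial L)
    (h : stateComplexity L = 7) : stateComplexity L.reverse ≤ 34 := by
  obtain ⟨n, M, hmin, rfl, hM⟩ := hL
  exact hM.stateComplexity_reverse_le (hmin.stateComplexity_eq_s8.symm.trans h)

theorem DFA.card_le_stateComplexity_reverse {α σ ι : Type} [Fintype σ] [Fintype ι] {M : DFA α σ}
    (hM : ∀ q, ∃ w, M.evalFrom M.start w = q) (g : ι → List α)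
    (hg : ∀ i j, (∀ q, M.evalFrom q (g i) ∈ M.accept ↔ M.evalFrom q (g j) ∈ M.accept) → i = j) :
    Fintype.card ι ≤ stateComplexity M.accepts.reverse := by
  have hreg : M.accepts.IsRegular := ⟨σ, inferInstance, M, rfl⟩
  refine card_le_stateComplexity hreg.reverse (fun i => (g i).reverse) fun i j h =>
    hg i j fun q => ?_
  obtain ⟨u, rfl⟩ := hM q
  simpa [Language.mem_reverse, DFA.mem_accepts, DFA.eval, DFA.evalFrom_of_append] using h u.reverse

/-! ### The witness -/

theorem DFA.acceptsFrom_eq_add {σ : Type} (M : DFA (Fin 2) σ) [DecidablePred (· ∈ M.accept)]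
    (q : σ) : M.acceptsFrom q = A8 * M.acceptsFrom (M.step q 0) + B8 * M.acceptsFrom (M.step q 1) +
      if q ∈ M.accept then 1 else 0 := by
  have hmul (a : Fin 2) (K : Language (Fin 2)) (w : List (Fin 2)) :
      w ∈ ({[a]} : Language (Fin 2)) * K ↔ ∃ v ∈ K, a :: v = w := by
    simp only [Language.mem_mul]
    exact ⟨by rintro ⟨_, rfl, v, hv, rfl⟩; exact ⟨v, hv, rfl⟩,
      fun ⟨v, hv, hw⟩ => ⟨[a], rfl, v, hv, hw⟩⟩
  have hone (w : List (Fin 2)) :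
      w ∈ (if q ∈ M.accept then 1 else 0 : Language (Fin 2)) ↔ w = [] ∧ q ∈ M.accept := by
    split_ifs with h <;> simp [h]
  ext w
  rw [Language.mem_add, Language.mem_add, A8, B8, hmul, hmul, hone]
  cases w with
  | nil => simp [DFA.mem_acceptsFrom]
  | cons a w => fin_cases a <;> simp [DFA.mem_acceptsFrom]

/-- The minimal automaton of the witness language. -/
def witnessDFA : DFA (Fin 2) (Fin 7) where
  step := ![![1, 0], ![2, 1], ![3, 3], ![4, 5], ![5, 4], ![5, 6], ![6, 6]]
  start := 0
  accept := {3, 4, 6}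

instance : DecidablePred (· ∈ witnessDFA.accept) := fun q =>
  inferInstanceAs (Decidable (q = 3 ∨ q = 4 ∨ q = 6))

theorem exists_evalFrom_witnessDFA_start (q : Fin 7) :
    ∃ w, witnessDFA.evalFrom witnessDFA.start w = q :=
  ⟨![[], [0], [0, 0], [0, 0, 0], [0, 0, 0, 0], [0, 0, 0, 1], [0, 0, 0, 1, 1]] q, by
    revert q; decide⟩

theorem witnessDFA_minimalDFA : witnessDFA.MinimalDFA := by
  refine ⟨exists_evalFrom_witnessDFA_start, fun p q hpq => ?_⟩
  have h : ∃ w ∈ [[], [0], [1], [0, 0], [0, 0, 0], [0, 0, 0, 0], [1, 1]],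
      ¬(witnessDFA.evalFrom p w ∈ witnessDFA.accept ↔
        witnessDFA.evalFrom q w ∈ witnessDFA.accept) := by
    revert p q
    decide
  exact h.imp fun w hw => hw.2

theorem witnessDFA_partiallyOrderedDFA : witnessDFA.PartiallyOrderedDFA := by
  have hstep : ∀ q a, q ≤ witnessDFA.step q a := by decide
  have hle (w : List (Fin 2)) (q : Fin 7) : q ≤ witnessDFA.evalFrom q w := by
    induction w generalizing q with
    | nil => exact le_rfl
    | cons a w ih => exact (hstep q a).trans (ih _)
  rintro p _ ⟨u, rfl⟩ ⟨v, hv⟩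
  exact le_antisymm (hle u p) ((hle v _).trans_eq hv)

theorem witnessDFA_accepts : witnessDFA.accepts = W8 := by
  have hnil (a : Fin 2) : [] ∉ ({[a]} : Language (Fin 2)) := fun h => by cases h
  have hA : [] ∉ A8 := hnil 0
  have hB : [] ∉ B8 := hnil 1
  have hAB : [] ∉ A8 + B8 := fun h => ((Language.mem_add ..).mp h).elim hA hB
  let K : Fin 7 → Language (Fin 2) := witnessDFA.acceptsFrom
  have e6 : K 6 = A8 * K 6 + B8 * K 6 + 1 := witnessDFA.acceptsFrom_eq_add 6
  have e5 : K 5 = A8 * K 5 + B8 * K 6 + 0 := witnessDFA.acceptsFrom_eq_add 5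
  have e4 : K 4 = A8 * K 5 + B8 * K 4 + 1 := witnessDFA.acceptsFrom_eq_add 4
  have e3 : K 3 = A8 * K 4 + B8 * K 5 + 1 := witnessDFA.acceptsFrom_eq_add 3
  have e2 : K 2 = A8 * K 3 + B8 * K 3 + 0 := witnessDFA.acceptsFrom_eq_add 2
  have e1 : K 1 = A8 * K 2 + B8 * K 1 + 0 := witnessDFA.acceptsFrom_eq_add 1
  have e0 : K 0 = A8 * K 1 + B8 * K 0 + 0 := witnessDFA.acceptsFrom_eq_add 0
  rw [← add_mul, Language.self_eq_mul_add_iff hAB, mul_one] at e6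
  rw [add_zero, Language.self_eq_mul_add_iff hA] at e5
  rw [add_comm (A8 * _), add_assoc, Language.self_eq_mul_add_iff hB] at e4
  rw [add_comm, ← add_assoc] at e3
  rw [add_zero, ← add_mul] at e2
  rw [add_zero, add_comm, Language.self_eq_mul_add_iff hB] at e1 e0
  change K 0 = W8
  rw [e0, e1, e2, e3, e4, e5, e6, W8]
  simp only [mul_assoc, mul_add, add_mul, mul_one, add_comm (B8∗)]

/-- Words that distinguish the states of the minimal automaton of `W8.reverse`. -/
def reverseWords : Fin 34 → List (Fin 2) :=
  ![[], [0], [1], [0, 0], [0, 1], [1, 0], [1, 1], [0, 0, 0], [0, 0, 1], [0, 1, 0], [0, 1, 1],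
    [1, 0, 0], [1, 0, 1], [1, 1, 0], [0, 0, 0, 0], [0, 0, 1, 0], [0, 1, 0, 0], [0, 1, 0, 1],
    [1, 0, 0, 0], [1, 1, 0, 0], [1, 1, 1, 0], [0, 0, 0, 0, 0], [0, 1, 1, 0, 0], [0, 1, 1, 1, 0],
    [1, 0, 0, 0, 0], [1, 1, 0, 0, 0], [1, 1, 1, 0, 0], [0, 0, 1, 1, 1, 0], [0, 1, 0, 0, 0, 0],
    [0, 1, 1, 1, 0, 0], [1, 0, 0, 0, 0, 0], [1, 1, 0, 0, 0, 0], [1, 1, 1, 0, 0, 0],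
    [1, 1, 1, 0, 0, 0, 0]]

theorem le_stateComplexity_W8_reverse : 34 ≤ stateComplexity W8.reverse := by
  rw [← witnessDFA_accepts]
  refine DFA.card_le_stateComplexity_reverse exists_evalFrom_witnessDFA_start reverseWords ?_
  decide +kernel

theorem isRTrivial_W8 : IsRTrivial W8 :=
  ⟨7, witnessDFA, witnessDFA_minimalDFA, witnessDFA_accepts, witnessDFA_partiallyOrderedDFA⟩

theorem stateComplexity_W8 : stateComplexity W8 = 7 := by
  rw [← witnessDFA_accepts]
  exact witnessDFA_minimalDFA.stateComplexity_eq_s8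

theorem statement8 :
    (∀ L : Language (Fin 2), IsRTrivial L → stateComplexity L = 7 →
      stateComplexity L.reverse ≤ 34) ∧
    IsRTrivial W8 ∧ stateComplexity W8 = 7 ∧ stateComplexity W8.reverse = 34 :=
  ⟨fun _ => IsRTrivial.stateComplexity_reverse_le, isRTrivial_W8, stateComplexity_W8,
    (isRTrivial_W8.stateComplexity_reverse_le stateComplexity_W8).antisymm
      le_stateComplexity_W8_reverse⟩
end
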